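/- For all 0 ≤ r,s ≤ n with Â_{rs} ≠ −1 (that is, r = s or r − s ≢ ±1 (mod n+1)) and all m, n ∈ ℤ^{N+1}, the Serre-type relations [ρ(E_r)_m, ρ(E_s)_n] = 0 and [ρ(F_r)_m, ρ(F_s)_n] = 0 hold as operators on V. -/

import Mathlib

noncomputable section

namespace Stmt15

/-- Multi-indices `m ∈ ℤ^{N+1}`. -/
abbrev MM (N : ℕ) := Fin (N + 1) → ℤ

/-- Index type for the polynomial variables `x_{ij}(m)`, `1 ≤ i < j ≤ n+1`. -/
def XIdx (n N : ℕ) := {ij : ℕ × ℕ // 1 ≤ ij.1 ∧ ij.1 < ij.2 ∧ ij.2 ≤ n + 1} × MM N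

/-- Index type for the polynomial variables `y_i(k)`, `1 ≤ i ≤ n`, `k > 0`. -/
def YIdx (n N : ℕ) (pos : MM N → Prop) :=
  {i : ℕ // 1 ≤ i ∧ i ≤ n} × {k : MM N // pos k}

/-- The Fock space `V = ℂ[x] ⊗ ℂ[y]`, realized as the polynomial ring in the
two (disjoint) families of variables. -/
abbrev Fock (n N : ℕ) (pos : MM N → Prop) :=
  MvPolynomial (XIdx n N ⊕ YIdx n N pos) ℂ

/-- `a_{ij,m}`: multiplication by `-x_{ij}(m)` (and `0` for out-of-range indices). -/
def aop (n N : ℕ) (pos : MM N → Prop) (i j : ℕ) (m : MM N) :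
    Fock n N pos → Fock n N pos := fun w =>
  if h : 1 ≤ i ∧ i < j ∧ j ≤ n + 1 then
    -(MvPolynomial.X (Sum.inl ((⟨(i, j), h⟩, m) : XIdx n N)) : Fock n N pos) * w
  else 0

/-- `a*_{ij,m}`: the partial derivative `∂/∂x_{ij}(-m)` (and `0` for
out-of-range indices). -/
def astar (n N : ℕ) (pos : MM N → Prop) (i j : ℕ) (m : MM N) :
    Fock n N pos → Fock n N pos := fun w =>
  if h : 1 ≤ i ∧ i < j ∧ j ≤ n + 1 then
    MvPolynomial.pderiv (Sum.inl ((⟨(i, j), h⟩, -m) : XIdx n N)) w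
  else 0

/-- `(κ·D a*_{ij})_v := Σ_{q ∈ ℤ^{N+1}} Σ_{p=0}^N κ_{q-v,p}(-q_p) a*_{ij,q}`,
a pointwise locally finite sum of operators. -/
def kD (n N : ℕ) (pos : MM N → Prop) (kappa : MM N → Fin (N + 1) → ℂ)
    (i j : ℕ) (v : MM N) : Fock n N pos → Fock n N pos := fun w =>
  ∑ᶠ q : MM N,
    (∑ p : Fin (N + 1), kappa (q - v) p * (-(q p : ℂ))) • astar n N pos i j q w

open Classical in
/-- `θ(m) = 1` if `m > 0` and `0` otherwise. -/
def theta {N : ℕ} (pos : MM N → Prop) (m : MM N) : ℂ := if pos m then 1 else 0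

open Classical in
/-- `∂/∂y_i(s)`, with the convention that it is `0` unless `1 ≤ i ≤ n` and `s > 0`. -/
def ydot (n N : ℕ) (pos : MM N → Prop) (i : ℕ) (s : MM N) :
    Fock n N pos → Fock n N pos := fun w =>
  if h : (1 ≤ i ∧ i ≤ n) ∧ pos s then
    MvPolynomial.pderiv (Sum.inr ((⟨i, h.1⟩, ⟨s, h.2⟩) : YIdx n N pos)) w
  else 0

/-- `Σ_{p=0}^N m_p κ_{-m+s,p}`. -/
def cnum {N : ℕ} (kappa : MM N → Fin (N + 1) → ℂ) (m s : MM N) : ℂ :=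
  ∑ p : Fin (N + 1), (m p : ℂ) * kappa (-m + s) p

open Classical in
/-- The operator `Φ(b_i(m))` (for `1 ≤ i ≤ n`), acting on `V`. -/
def Phi (n N : ℕ) (pos : MM N → Prop) (kappa : MM N → Fin (N + 1) → ℂ)
    (lam : ℕ → ℂ) (i : ℕ) (m : MM N) : Fock n N pos → Fock n N pos := fun w =>
  theta pos (-m) • (∑ᶠ s : MM N, cnum kappa m s •
      (ydot n N pos (i - 1) s w - ydot n N pos i s w))
  + theta pos m • (∑ᶠ s : MM N, cnum kappa m s •
      (ydot n N pos (i - 1) s w - (2 : ℂ) • ydot n N pos i s w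
        + ydot n N pos (i + 1) s w))
  + (if h : (1 ≤ i ∧ i ≤ n) ∧ pos (-m) then
      (MvPolynomial.X (Sum.inr ((⟨i, h.1⟩, ⟨-m, h.2⟩) : YIdx n N pos)) :
          Fock n N pos) * w
    else 0)
  - (if m = 0 then lam i else 0) • w

/-- `Φ(b_0(m)) := -Σ_{i=1}^n Φ(b_i(m))`, and `Φ(b_i(m))` for `1 ≤ i ≤ n`. -/
def PhiHat (n N : ℕ) (pos : MM N → Prop) (kappa : MM N → Fin (N + 1) → ℂ)
    (lam : ℕ → ℂ) (i : ℕ) (m : MM N) : Fock n N pos → Fock n N pos :=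
  if i = 0 then -(∑ r ∈ Finset.Icc 1 n, Phi n N pos kappa lam r m)
  else Phi n N pos kappa lam i m

/-- The `m`-th mode of the product of two families of operators:
`(XY)_m := Σ_{k+l=m} X_k Y_l` (pointwise locally finite sum). -/
def fmul (n N : ℕ) (pos : MM N → Prop)
    (X Y : MM N → Fock n N pos → Fock n N pos) :
    MM N → Fock n N pos → Fock n N pos :=
  fun m w => ∑ᶠ k : MM N, X k (Y (m - k) w)

/-- Modewise product of a finite list of families of operators; the empty
product is the identity family (the delta family supported at `0`). -/
def fprod (n N : ℕ) (pos : MM N → Prop) :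
    List (MM N → Fock n N pos → Fock n N pos) →
      MM N → Fock n N pos → Fock n N pos
  | [] => fun m w => if m = 0 then w else 0
  | X :: L => fmul n N pos X (fprod n N pos L)

/-- The affine Cartan matrix of type `A_n^{(1)}` (indices `0 ≤ i, j ≤ n`), as an
integer matrix. -/
def AcarZ (n i j : ℕ) : ℤ :=
  if i = j then 2
  else if (i + 1) % (n + 1) = j % (n + 1) ∨ (j + 1) % (n + 1) = i % (n + 1) then -1
  else 0

/-- The affine Cartan matrix of type `A_n^{(1)}`, with complex entries. -/
def Acar (n i j : ℕ) : ℂ := (AcarZ n i j : ℂ)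

/-- `ρ(F_r)_m` for `1 ≤ r ≤ n`. -/
def rhoF (n N : ℕ) (pos : MM N → Prop) (r : ℕ) (m : MM N) :
    Fock n N pos → Fock n N pos :=
  aop n N pos r (r + 1) m
    - ∑ j ∈ Finset.Ico 1 r, fmul n N pos (aop n N pos j (r + 1)) (astar n N pos j r) m

/-- `ρ(H_r)_m` for `1 ≤ r ≤ n`. -/
def rhoHn (n N : ℕ) (pos : MM N → Prop) (kappa : MM N → Fin (N + 1) → ℂ)
    (lam : ℕ → ℂ) (r : ℕ) (m : MM N) : Fock n N pos → Fock n N pos :=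
  (2 : ℂ) • fmul n N pos (aop n N pos r (r + 1)) (astar n N pos r (r + 1)) m
  + ∑ i ∈ Finset.Ico 1 r,
      (fmul n N pos (aop n N pos i (r + 1)) (astar n N pos i (r + 1)) m
        - fmul n N pos (aop n N pos i r) (astar n N pos i r) m)
  + ∑ j ∈ Finset.Icc (r + 2) (n + 1),
      (fmul n N pos (aop n N pos r j) (astar n N pos r j) m
        - fmul n N pos (aop n N pos (r + 1) j) (astar n N pos (r + 1) j) m)
  + Phi n N pos kappa lam r m

/-- `ρ(H_r)_m` for `0 ≤ r ≤ n`, with `ρ(H_0)_m := -Σ_{r=1}^n ρ(H_r)_m`. -/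
def rhoH (n N : ℕ) (pos : MM N → Prop) (kappa : MM N → Fin (N + 1) → ℂ)
    (lam : ℕ → ℂ) (r : ℕ) (m : MM N) : Fock n N pos → Fock n N pos :=
  if r = 0 then -(∑ s ∈ Finset.Icc 1 n, rhoHn n N pos kappa lam s m)
  else rhoHn n N pos kappa lam r m

/-- `ρ(E_r)_m` for `1 ≤ r ≤ n`. -/
def rhoEn (n N : ℕ) (pos : MM N → Prop) (kappa : MM N → Fin (N + 1) → ℂ)
    (lam : ℕ → ℂ) (r : ℕ) (m : MM N) : Fock n N pos → Fock n N pos :=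
  fmul n N pos (aop n N pos r (r + 1))
      (fmul n N pos (astar n N pos r (r + 1)) (astar n N pos r (r + 1))) m
  - ∑ j ∈ Finset.Icc (r + 2) (n + 1),
      fmul n N pos (aop n N pos (r + 1) j) (astar n N pos r j) m
  + ∑ j ∈ Finset.Ico 1 r,
      fmul n N pos (aop n N pos j r) (astar n N pos j (r + 1)) m
  + ∑ j ∈ Finset.Icc (r + 2) (n + 1),
      (fmul n N pos (fmul n N pos (aop n N pos r j) (astar n N pos r j))
          (astar n N pos r (r + 1)) m
        - fmul n N pos (fmul n N pos (aop n N pos (r + 1) j) (astar n N pos (r + 1) j))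
            (astar n N pos r (r + 1)) m)
  + fmul n N pos (astar n N pos r (r + 1)) (Phi n N pos kappa lam r) m
  + kD n N pos kappa r (r + 1) m

/-- `ρ(E_r)_m` for `0 ≤ r ≤ n`, with `ρ(E_0)_m := -a_{1,n+1;m}`. -/
def rhoE (n N : ℕ) (pos : MM N → Prop) (kappa : MM N → Fin (N + 1) → ℂ)
    (lam : ℕ → ℂ) (r : ℕ) (m : MM N) : Fock n N pos → Fock n N pos :=
  if r = 0 then -(aop n N pos 1 (n + 1) m) else rhoEn n N pos kappa lam r m

/-- The strictly increasing sequence `1 = q_1 < q_2 < ⋯ < q_i` encoded by a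
subset `s ⊆ {2,…,n+1}`, as the sorted list `1 :: sort s`. -/
def ql (s : Finset ℕ) : List ℕ := 1 :: s.sort (· ≤ ·)

/-- The last entry `q_i` of the sequence encoded by `s`. -/
def qend (s : Finset ℕ) : ℕ := ((ql s).getLast?).getD 0

/-- The second-to-last entry `q_{i-1}` of the sequence encoded by `s`
(`0` if the sequence has length `1`, so that the condition `q_{i-1} ≤ r` is
vacuous in that case). -/
def qpen (s : Finset ℕ) : ℕ := (((ql s).dropLast).getLast?).getD 0

/-- The list of adjacent pairs `(q_l, q_{l+1})` of a list. -/
def qpairs (l : List ℕ) : List (ℕ × ℕ) := l.zip l.tail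

/-- `ρ(F_0)_m`. -/
def rhoF0 (n N : ℕ) (pos : MM N → Prop) (kappa : MM N → Fin (N + 1) → ℂ)
    (lam : ℕ → ℂ) (m : MM N) : Fock n N pos → Fock n N pos :=
  -(∑ r ∈ Finset.Icc 1 (n + 1), ∑ j ∈ Finset.Icc 1 (n + 1),
      ∑ s ∈ (Finset.Icc 2 (n + 1)).powerset,
        if r < j ∧ qend s = j ∧ qpen s ≤ r then
          fprod n N pos
            (aop n N pos r j ::
              ((qpairs (ql s)).map fun p => astar n N pos p.1 p.2)
                ++ [astar n N pos r (n + 1)]) m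
        else 0)
  - (∑ r ∈ Finset.Icc 1 n, ∑ s ∈ (Finset.Icc 2 (n + 1)).powerset,
      if qend s ≤ r then
        fprod n N pos
          (((qpairs (ql s ++ [n + 1])).map fun p => astar n N pos p.1 p.2)
            ++ [Phi n N pos kappa lam r]) m
      else 0)
  - (∑ r ∈ Finset.Icc 1 n, ∑ s ∈ (Finset.Icc 2 (n + 1)).powerset,
      if qend s = r then
        fprod n N pos
          (((qpairs (ql s)).map fun p => astar n N pos p.1 p.2)
            ++ [kD n N pos kappa r (n + 1)]) m
      else 0)

/-- `ρ(F_r)_m` for `0 ≤ r ≤ n`. -/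
def rhoFa (n N : ℕ) (pos : MM N → Prop) (kappa : MM N → Fin (N + 1) → ℂ)
    (lam : ℕ → ℂ) (r : ℕ) (m : MM N) : Fock n N pos → Fock n N pos :=
  if r = 0 then rhoF0 n N pos kappa lam m else rhoF n N pos r m

/-- The commutator of two operators. -/
def comm {V : Type*} [AddCommGroup V] (f g : V → V) : V → V :=
  fun w => f (g w) - g (f w)

section Modes

variable {M V I : Type*} [AddCommGroup M] [AddCommGroup V] [Module ℂ V]

/-- A family of operators is locally finite if each vector is killed by all but finitely many
of its members. -/
def LocFin (X : M → Module.End ℂ V) : Prop := ∀ w, (Function.support fun m => X m w).Finite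

/-- The generating series of a locally finite family. -/
def series (X : M → Module.End ℂ V) (h : LocFin X) : V →ₗ[ℂ] M →₀ V where
  toFun w := Finsupp.ofSupportFinite (fun m => X m w) (h w)
  map_add' v w := Finsupp.ext fun m => map_add (X m) v w
  map_smul' c w := Finsupp.ext fun m => map_smul (X m) c w

omit [AddCommGroup M] in
@[simp] lemma series_apply (X : M → Module.End ℂ V) (h : LocFin X) (w : V) (m : M) :
    series X h w m = X m w := rfl

/-- The shift-equivariant extension of a generating series to `V`-valued Laurent polynomials. -/
def conv (X : M → Module.End ℂ V) (h : LocFin X) : Module.End ℂ (M →₀ V) :=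
  Finsupp.lsum ℂ fun l => Finsupp.lmapDomain V ℂ (· + l) ∘ₗ series X h

omit [Module ℂ V] in
lemma mapDomain_add_apply (f : M →₀ V) (l m : M) :
    Finsupp.mapDomain (· + l) f m = f (m - l) := by
  have := Finsupp.mapDomain_apply (add_left_injective l) f (m - l)
  simpa using this

lemma conv_single (X : M → Module.End ℂ V) (h : LocFin X) (l m : M) (w : V) :
    conv X h (Finsupp.single l w) m = X (m - l) w := by
  simp [conv, mapDomain_add_apply]

lemma conv_apply (X : M → Module.End ℂ V) (h : LocFin X) (f : M →₀ V) (m : M) :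
    conv X h f m = ∑ᶠ k, X (m - k) (f k) := by
  rw [finsum_eq_sum_of_support_subset (s := f.support)]
  · simp [conv, Finsupp.sum, Finsupp.finsetSum_apply, mapDomain_add_apply]
  · intro k hk
    simp only [Function.mem_support] at hk
    simp only [Finset.mem_coe, Finsupp.mem_support_iff]
    intro h0
    exact hk (by simp [h0])

lemma conv_mul_single (X Y : M → Module.End ℂ V) (hX : LocFin X) (hY : LocFin Y)
    (l m : M) (w : V) :
    (conv X hX * conv Y hY) (Finsupp.single l w) m = ∑ᶠ k, X k (Y (m - l - k) w) := by
  rw [Module.End.mul_apply, conv_apply, ← finsum_comp_equiv (Equiv.subLeft m)]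
  refine finsum_congr fun k => ?_
  rw [conv_single]
  simp [sub_right_comm]

lemma commute_conv {X Y : M → Module.End ℂ V} (hX : LocFin X) (hY : LocFin Y)
    (h : ∀ m k, Commute (X m) (Y k)) : Commute (conv X hX) (conv Y hY) := by
  refine Finsupp.lhom_ext fun l w => Finsupp.ext fun m => ?_
  rw [conv_mul_single, conv_mul_single, ← finsum_comp_equiv (Equiv.subLeft (m - l))]
  refine finsum_congr fun k => ?_
  have := congrArg (fun A => A w) (h (m - l - k) k).eq
  simpa using this

/-- Pairwise commuting locally finite families of operators. -/
structure CommutingFields (M V I : Type*) [AddCommGroup M] [AddCommGroup V] [Module ℂ V] where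
  /-- the modes of the fields -/
  gam : I → M → Module.End ℂ V
  locFin : ∀ i, LocFin (gam i)
  commute : ∀ i j m k, Commute (gam i m) (gam j k)

namespace CommutingFields

variable (S : CommutingFields M V I)

open scoped IsMulCommutative in
/-- Evaluation of polynomials at commuting fields. -/
def ev : MvPolynomial I ℂ →ₐ[ℂ] Module.End ℂ (M →₀ V) :=
  let T : Set (Module.End ℂ (M →₀ V)) := Set.range fun i => conv (S.gam i) (S.locFin i)
  have hT : ∀ x ∈ T, ∀ y ∈ T, x * y = y * x := by
    rintro _ ⟨i, rfl⟩ _ ⟨j, rfl⟩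
    exact commute_conv _ _ (S.commute i j)
  haveI := Algebra.isMulCommutative_adjoin ℂ hT
  (Algebra.adjoin ℂ T).val.comp
    (MvPolynomial.aeval fun i => (⟨_, Algebra.subset_adjoin ⟨i, rfl⟩⟩ : Algebra.adjoin ℂ T))

@[simp] lemma ev_X (i : I) : S.ev (MvPolynomial.X i) = conv (S.gam i) (S.locFin i) := by
  simp [ev]

lemma commute_ev {A : Module.End ℂ (M →₀ V)}
    (hA : ∀ i, Commute A (conv (S.gam i) (S.locFin i))) (f : MvPolynomial I ℂ) :
    Commute A (S.ev f) := by
  induction f using MvPolynomial.induction_on with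
  | C a =>
    rw [← MvPolynomial.algebraMap_eq, AlgHom.commutes]
    exact Algebra.commute_algebraMap_right a A
  | add p q hp hq => rw [map_add]; exact hp.add_right hq
  | mul_X p i hp => rw [map_mul, ev_X]; exact hp.mul_right (hA i)

/-- The modes of a polynomial in commuting fields. -/
def mode (f : MvPolynomial I ℂ) (m : M) : Module.End ℂ V :=
  Finsupp.lapply m ∘ₗ S.ev f ∘ₗ Finsupp.lsingle 0

lemma mode_apply (f : MvPolynomial I ℂ) (m : M) (w : V) :
    S.mode f m w = S.ev f (Finsupp.single 0 w) m := rfl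

lemma locFin_mode (f : MvPolynomial I ℂ) : LocFin (S.mode f) := fun w => by
  simpa only [mode_apply, Finsupp.fun_support_eq] using Finset.finite_toSet _

lemma mode_add (f g : MvPolynomial I ℂ) (m : M) : S.mode (f + g) m = S.mode f m + S.mode g m := by
  ext w; simp [mode_apply]

lemma mode_smul (c : ℂ) (f : MvPolynomial I ℂ) (m : M) : S.mode (c • f) m = c • S.mode f m := by
  ext w; simp [mode_apply]

lemma mode_zero (m : M) : S.mode 0 m = 0 := by
  ext w; simp [mode_apply]

lemma mode_C (c : ℂ) (m : M) (w : V) [Decidable (m = 0)] :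
    S.mode (MvPolynomial.C c) m w = if m = 0 then c • w else 0 := by
  rw [mode_apply, ← MvPolynomial.algebraMap_eq, AlgHom.commutes]
  classical
  simp only [Module.algebraMap_end_apply, Finsupp.smul_single, Finsupp.single_apply, eq_comm]

lemma mode_one (m : M) (w : V) [Decidable (m = 0)] :
    S.mode 1 m w = if m = 0 then w else 0 := by
  rw [← MvPolynomial.C_1, mode_C]; simp

lemma mode_X (i : I) (m : M) : S.mode (MvPolynomial.X i) m = S.gam i m := by
  ext w; simp [mode_apply, conv_single]

lemma ev_single (f : MvPolynomial I ℂ) (l m : M) (w : V) :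
    S.ev f (Finsupp.single l w) m = S.mode f (m - l) w := by
  have h : Commute (Finsupp.lmapDomain V ℂ (· + l)) (S.ev f) := by
    refine S.commute_ev (fun i => ?_) f
    refine Finsupp.lhom_ext fun k w => Finsupp.ext fun m => ?_
    simp [mapDomain_add_apply, conv_single, sub_sub, add_comm l k]
  have h2 := congrArg (fun A => A (Finsupp.single 0 w) m) h.eq
  simp [mapDomain_add_apply] at h2
  rw [← h2, mode_apply]

lemma ev_apply (f : MvPolynomial I ℂ) (h : M →₀ V) (m : M) :
    S.ev f h m = ∑ᶠ k, S.mode f (m - k) (h k) := by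
  rw [finsum_eq_sum_of_support_subset (s := h.support)]
  · conv_lhs => rw [← Finsupp.sum_single h]
    simp [Finsupp.sum, Finsupp.finsetSum_apply, ev_single]
  · intro k hk
    simp only [Function.mem_support] at hk
    simp only [Finset.mem_coe, Finsupp.mem_support_iff]
    intro h0
    exact hk (by simp [h0])

lemma mode_mul (f g : MvPolynomial I ℂ) (m : M) (w : V) :
    S.mode (f * g) m w = ∑ᶠ k, S.mode f k (S.mode g (m - k) w) := by
  rw [mode_apply, map_mul, Module.End.mul_apply, ev_apply, ← finsum_comp_equiv (Equiv.subLeft m)]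
  simp [mode_apply]

lemma commute_mode_of_commute_gam {A : Module.End ℂ V} (h : ∀ i m, Commute A (S.gam i m))
    (f : MvPolynomial I ℂ) (m : M) : Commute A (S.mode f m) := by
  have hA : Commute (Finsupp.mapRange.linearMap A) (S.ev f) := by
    refine S.commute_ev (fun i => ?_) f
    refine Finsupp.lhom_ext fun k w => Finsupp.ext fun m => ?_
    have := congrArg (fun A => A w) (h i (m - k)).eq
    simpa [conv_single] using this
  ext w
  have h2 := congrArg (fun A => A (Finsupp.single 0 w) m) hA.eq
  simpa [mode_apply] using h2

lemma commute_mode (f g : MvPolynomial I ℂ) (m k : M) : Commute (S.mode f m) (S.mode g k) :=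
  S.commute_mode_of_commute_gam (fun i l =>
    (S.commute_mode_of_commute_gam (fun j _ => S.commute i j l _) f m).symm) g k

/-- A linear combination of an arbitrary family of operators weighted by the modes of a
polynomial: the `m`-th mode of the normally ordered product of `t` and `f`. -/
def smear (t : M → Module.End ℂ V) (m : M) : MvPolynomial I ℂ →ₗ[ℂ] Module.End ℂ V where
  toFun f := (Finsupp.lsum ℂ fun q => t (m - q)) ∘ₗ S.ev f ∘ₗ Finsupp.lsingle 0
  map_add' f g := by rw [map_add, LinearMap.add_comp, LinearMap.comp_add]
  map_smul' c f := by rw [map_smul, LinearMap.smul_comp, LinearMap.comp_smul, RingHom.id_apply]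

lemma smear_apply (t : M → Module.End ℂ V) (m : M) (f : MvPolynomial I ℂ) (w : V) :
    S.smear t m f w = ∑ᶠ q, t (m - q) (S.mode f q w) := by
  rw [finsum_eq_sum_of_support_subset (s := (S.ev f (Finsupp.single 0 w)).support)]
  · simp [smear, Finsupp.sum, mode_apply]
  · intro k hk
    simp only [Function.mem_support] at hk
    simp only [Finset.mem_coe, Finsupp.mem_support_iff]
    intro h0
    exact hk (by simp [mode_apply, h0])

lemma finite_support_mode (f : MvPolynomial I ℂ) (t : M → Module.End ℂ V) (w : V) :
    (Function.support fun q => t q (S.mode f q w)).Finite :=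
  (S.locFin_mode f w).subset fun q hq => by
    simp only [Function.mem_support] at hq ⊢
    exact fun h0 => hq (by simp [h0])

lemma finite_support_mode_mode (f g : MvPolynomial I ℂ) (Ψ : M → M → Module.End ℂ V) (w : V) :
    (Function.support fun x : M × M => Ψ x.1 x.2 (S.mode f x.1 (S.mode g x.2 w))).Finite := by
  refine ((S.locFin_mode g w).biUnion fun q _ =>
    ((S.locFin_mode f (S.mode g q w)).image fun p => (p, q))).subset ?_
  rintro ⟨p, q⟩ h
  simp only [Function.mem_support] at h
  simp only [Set.mem_iUnion, Set.mem_image, Function.mem_support]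
  refine ⟨q, fun h0 => h (by simp [h0]), p, fun h0 => h (by simp [h0]), rfl⟩

/-- Weighted double sums over the modes of two polynomials. -/
def bisum (Ψ : M → M → Module.End ℂ V) (f g : MvPolynomial I ℂ) (w : V) : V :=
  ∑ᶠ x : M × M, Ψ x.1 x.2 (S.mode f x.1 (S.mode g x.2 w))

lemma bisum_comm (Ψ : M → M → Module.End ℂ V) (f g : MvPolynomial I ℂ) (w : V) :
    S.bisum Ψ f g w = S.bisum (fun p q => Ψ q p) g f w := by
  rw [bisum, bisum, ← finsum_comp_equiv (Equiv.prodComm M M)]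
  refine finsum_congr fun x => ?_
  have := congrArg (fun A => A w) (S.commute_mode f g x.2 x.1).eq
  simp only [Module.End.mul_apply] at this
  simp [this]

lemma bisum_eq (Ψ : M → M → Module.End ℂ V) (f g : MvPolynomial I ℂ) (w : V) :
    S.bisum Ψ f g w = ∑ᶠ q, ∑ᶠ p, Ψ p q (S.mode f p (S.mode g q w)) := by
  rw [bisum, ← finsum_comp_equiv (Equiv.prodComm M M), finsum_curry]
  · rfl
  · exact (S.finite_support_mode_mode f g Ψ w).preimage (Equiv.injective _).injOn

lemma bisum_add (Ψ Ψ' : M → M → Module.End ℂ V) (f g : MvPolynomial I ℂ) (w : V) :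
    S.bisum (Ψ + Ψ') f g w = S.bisum Ψ f g w + S.bisum Ψ' f g w := by
  simp only [bisum, Pi.add_apply, LinearMap.add_apply]
  exact finsum_add_distrib (S.finite_support_mode_mode f g Ψ w)
    (S.finite_support_mode_mode f g Ψ' w)

lemma bisum_smul (c : ℂ) (Ψ : M → M → Module.End ℂ V) (f g : MvPolynomial I ℂ) (w : V) :
    S.bisum (c • Ψ) f g w = c • S.bisum Ψ f g w := by
  simp only [bisum, Pi.smul_apply, LinearMap.smul_apply, smul_finsum]

lemma bisum_sub (Ψ Ψ' : M → M → Module.End ℂ V) (f g : MvPolynomial I ℂ) (w : V) :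
    S.bisum (Ψ - Ψ') f g w = S.bisum Ψ f g w - S.bisum Ψ' f g w := by
  rw [sub_eq_add_neg, bisum_add, ← neg_one_smul ℂ Ψ', bisum_smul]
  simp [sub_eq_add_neg]

lemma finite_support_conv (f g : MvPolynomial I ℂ) (u : M) (w : V) :
    (Function.support fun k => S.mode f k (S.mode g (u - k) w)).Finite := by
  have := S.finite_support_mode_mode f g (fun _ _ => 1) w
  exact (this.image Prod.fst).subset fun k hk => ⟨(k, u - k), by simpa using hk, rfl⟩

lemma bisum_total (Ψ : M → Module.End ℂ V) (f g : MvPolynomial I ℂ) (w : V) :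
    S.bisum (fun p q => Ψ (p + q)) f g w = ∑ᶠ u, Ψ u (S.mode (f * g) u w) := by
  simp only [mode_mul]
  let e : M × M ≃ M × M :=
    { toFun := fun x => (x.2, x.1 - x.2)
      invFun := fun x => (x.1 + x.2, x.1)
      left_inv := fun x => by simp
      right_inv := fun x => by simp }
  rw [bisum, ← finsum_comp_equiv e, finsum_curry]
  · refine finsum_congr fun u => ?_
    rw [map_finsum]
    · simp [e]
    · exact S.finite_support_conv f g u w
  · exact (S.finite_support_mode_mode f g (fun p q => Ψ (p + q)) w).preimage
      (Equiv.injective _).injOn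

lemma smear_one (t : M → Module.End ℂ V) (m : M) (w : V) : S.smear t m 1 w = t m w := by
  classical
  rw [S.smear_apply, finsum_eq_single _ 0]
  · simp [S.mode_one]
  · intro q hq
    simp [S.mode_one, hq]

lemma finsum_smear_mode (t : M → Module.End ℂ V) (f g : MvPolynomial I ℂ) (m : M) (w : V) :
    ∑ᶠ k, S.smear t k f (S.mode g (m - k) w) = S.smear t m (f * g) w := by
  rw [S.smear_apply t m (f * g), ← S.bisum_total (fun u => t (m - u)), S.bisum_eq,
    ← finsum_comp_equiv (Equiv.subLeft m)]
  refine finsum_congr fun q => ?_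
  rw [S.smear_apply]
  simp [sub_sub, add_comm]

lemma finsum_mode_smear {t : M → Module.End ℂ V} (ht : ∀ i u p, Commute (t u) (S.gam i p))
    (f g : MvPolynomial I ℂ) (m : M) (w : V) :
    ∑ᶠ k, S.mode f k (S.smear t (m - k) g w) = S.smear t m (f * g) w := by
  rw [mul_comm, S.smear_apply t m (g * f), ← S.bisum_total (fun u => t (m - u)), S.bisum_eq]
  refine finsum_congr fun k => ?_
  rw [S.smear_apply, map_finsum]
  · refine finsum_congr fun q => ?_
    have h1 := congrArg (fun A => A (S.mode g q w))
      (S.commute_mode_of_commute_gam (fun i p => ht i (m - k - q) p) f k).eq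
    have h2 := congrArg (fun A => A w) (S.commute_mode f g k q).eq
    simp only [Module.End.mul_apply] at h1 h2
    rw [← h1, h2, sub_sub, add_comm k q]
  · exact S.finite_support_mode g (fun q => t (m - k - q)) w

end CommutingFields

end Modes

section FirstOrder

variable {M V I G : Type*} [AddCommGroup M] [AddCommGroup V] [Module ℂ V]

open Classical in
/-- Commuting fields together with families of operators whose commutators with the fields and
with each other are scalars, the latter being given by a two-variable function `c` whose
symmetrization depends on the sum of its shifts only. -/
structure FreeFields (M V I G : Type*) [AddCommGroup M] [AddCommGroup V] [Module ℂ V]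
    extends CommutingFields M V I where
  /-- the additional families of operators -/
  gen : G → M → Module.End ℂ V
  /-- the contractions between `gen` and the fields -/
  eps : G → I → ℂ
  gen_gam : ∀ g i u p, gen g u * gam i p - gam i p * gen g u =
    if u + p = 0 then eps g i • 1 else 0
  /-- the symmetric form on the additional families -/
  form : G → G → ℂ
  /-- the scalar cocycle -/
  cocycle : M → M → ℂ
  gen_gen : ∀ g h u v, gen g u * gen h v - gen h v * gen g u = (form g h * cocycle u v) • 1
  form_symm : ∀ g h, form g h = form h g
  /-- the symmetrized cocycle -/
  symmCocycle : M → M → M → ℂ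
  cocycle_symm : ∀ m k p q, cocycle (m - p) (k - q) + cocycle (m - q) (k - p) =
    symmCocycle m k (p + q)

namespace FreeFields

variable (S : FreeFields M V I G)

/-- The derivation of polynomials in the fields induced by the commutator with `gen g`. -/
def der (g : G) : Derivation ℂ (MvPolynomial I ℂ) (MvPolynomial I ℂ) :=
  MvPolynomial.mkDerivation ℂ fun i => MvPolynomial.C (S.eps g i)

lemma gen_mode (g : G) (f : MvPolynomial I ℂ) (u p : M) (w : V) :
    S.gen g u (S.mode f p w) = S.mode f p (S.gen g u w) + S.mode (S.der g f) (u + p) w := by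
  classical
  induction f using MvPolynomial.induction_on generalizing p w with
  | C a =>
    rw [MvPolynomial.derivation_C, S.mode_zero]
    simp only [S.mode_C]
    split_ifs <;> simp
  | add f g hf hg => 
    rw [map_add]
    simp only [S.mode_add, LinearMap.add_apply, map_add, hf, hg]
    abel
  | mul_X f i hf =>
    have hX : ∀ (q : M) (w : V), S.gen g u (S.mode (.X i) q w) =
        S.mode (.X i) q (S.gen g u w) + if u + q = 0 then S.eps g i • w else 0 := by
      intro q w
      have h := congrArg (fun A => A w) (S.gen_gam g i u q)
      simp only [LinearMap.sub_apply, Module.End.mul_apply, sub_eq_iff_eq_add'] at h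
      rw [S.mode_X, h]
      split_ifs <;> simp
    have hd : S.der g (f * .X i) = S.eps g i • f + S.der g f * .X i := by
      rw [Derivation.leibniz, der, MvPolynomial.mkDerivation_X, MvPolynomial.smul_eq_C_mul]
      simp only [smul_eq_mul]
      ring
    have h1 : S.mode f (u + p) (S.eps g i • w) =
        ∑ᶠ k, S.mode f k (if u + (p - k) = 0 then S.eps g i • w else 0) := by
      rw [finsum_eq_single _ (u + p)]
      · simp
      · intro k hk
        rw [if_neg, map_zero]
        intro h
        exact hk (by rw [← sub_eq_zero, ← neg_eq_zero, ← h]; abel)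
    have h2 : S.mode (S.der g f * .X i) (u + p) w =
        ∑ᶠ k, S.mode (S.der g f) (u + k) (S.mode (.X i) (p - k) w) := by
      rw [S.mode_mul, ← finsum_comp_equiv (Equiv.addLeft u)]
      simp
    have fin2 : (Function.support fun k =>
        S.mode (S.der g f) (u + k) (S.mode (.X i) (p - k) w)).Finite := by
      refine ((S.finite_support_conv (S.der g f) (.X i) (u + p) w).preimage
        (Equiv.addLeft u).injective.injOn).subset fun k hk => ?_
      simpa using hk
    have fin1 : (Function.support fun k =>
        S.mode f k (if u + (p - k) = 0 then S.eps g i • w else 0)).Finite := by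
      refine (Set.finite_singleton (u + p)).subset fun k hk => ?_
      simp only [Function.mem_support] at hk
      by_contra h
      refine hk ?_
      rw [if_neg, map_zero]
      intro h'
      exact h (Set.mem_singleton_iff.2 (by rw [← sub_eq_zero, ← neg_eq_zero, ← h']; abel))
    have fin0 := S.finite_support_conv f (.X i) p (S.gen g u w)
    rw [hd, S.mode_add, S.mode_smul, LinearMap.add_apply, LinearMap.smul_apply, ← map_smul, h1, h2,
      S.mode_mul, S.mode_mul, map_finsum _ (S.finite_support_conv f (.X i) p w), ← add_assoc,
      ← finsum_add_distrib fin0 fin1, ← finsum_add_distrib ?_ fin2]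
    · refine finsum_congr fun k => ?_
      rw [hf, hX, map_add]
    · refine (fin0.union fin1).subset ?_
      exact Function.support_add _ _

lemma smear_smear (g h : G) (m k : M) (f e : MvPolynomial I ℂ) (w : V) :
    S.smear (S.gen g) m f (S.smear (S.gen h) k e w) =
      S.bisum (fun p q => S.gen g (m - p) * S.gen h (k - q)) f e w -
        S.smear (S.gen g) (m + k) (S.der h f * e) w := by
  have h2 : S.smear (S.gen g) (m + k) (S.der h f * e) w =
      ∑ᶠ q, ∑ᶠ p, S.gen g (m - p) (S.mode (S.der h f) (k - q + p) (S.mode e q w)) := by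
    rw [S.smear_apply, ← S.bisum_total (fun u => S.gen g (m + k - u)), S.bisum_eq]
    refine finsum_congr fun q => ?_
    rw [← finsum_comp_equiv (Equiv.addLeft (k - q))]
    refine finsum_congr fun p => ?_
    simp only [Equiv.coe_addLeft]
    congr 2
    abel
  have fin1 : ∀ q, (Function.support fun p =>
      S.gen g (m - p) (S.gen h (k - q) (S.mode f p (S.mode e q w)))).Finite := fun q =>
    (S.locFin_mode f (S.mode e q w)).subset fun p hp => by
      simp only [Function.mem_support] at hp ⊢
      exact fun h0 => hp (by simp [h0])
  have fin2 : ∀ q, (Function.support fun p =>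
      S.gen g (m - p) (S.mode (S.der h f) (k - q + p) (S.mode e q w))).Finite := fun q =>
    ((S.locFin_mode (S.der h f) (S.mode e q w)).preimage
      (Equiv.addLeft (k - q)).injective.injOn).subset fun p hp => by
      simp only [Set.mem_preimage, Function.mem_support, Equiv.coe_addLeft] at hp ⊢
      exact fun h0 => hp (by simp [h0])
  have fin3 : ∀ F : M → V → V, (∀ q, F q 0 = 0) →
      (Function.support fun q => F q (S.mode e q w)).Finite := fun F hF =>
    (S.locFin_mode e w).subset fun q hq => by
      simp only [Function.mem_support] at hq ⊢
      exact fun h0 => hq (by simp [h0, hF])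
  rw [S.smear_apply (S.gen h), map_finsum, h2, S.bisum_eq, ← finsum_sub_distrib]
  · refine finsum_congr fun q => ?_
    simp only [Module.End.mul_apply]
    rw [S.smear_apply, ← finsum_sub_distrib (fin1 q) (fin2 q)]
    refine finsum_congr fun p => ?_
    rw [← map_sub, S.gen_mode h f, add_sub_cancel_right]
  · exact fin3 (fun q z => ∑ᶠ p, S.gen g (m - p) (S.gen h (k - q) (S.mode f p z))) (by simp)
  · exact fin3 (fun q z => ∑ᶠ p, S.gen g (m - p) (S.mode (S.der h f) (k - q + p) z)) (by simp)
  · exact fin3 (fun q z => S.gen h (k - q) z) (by simp)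

lemma smear_comm (g h : G) (m k : M) (f e : MvPolynomial I ℂ) (w : V) :
    S.smear (S.gen g) m f (S.smear (S.gen h) k e w) -
      S.smear (S.gen h) k e (S.smear (S.gen g) m f w) =
      S.form g h • S.bisum (fun p q => S.cocycle (m - p) (k - q) • 1) f e w -
        S.smear (S.gen g) (m + k) (S.der h f * e) w +
        S.smear (S.gen h) (m + k) (S.der g e * f) w := by
  rw [smear_smear, smear_smear, S.bisum_comm _ e f, ← S.bisum_smul, add_comm k m]
  have : (S.form g h • fun p q => S.cocycle (m - p) (k - q) • (1 : Module.End ℂ V)) =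
      (fun p q => S.gen g (m - p) * S.gen h (k - q)) -
        (fun p q => S.gen h (k - q) * S.gen g (m - p)) := by
    ext p q
    simp [S.gen_gen, smul_smul]
  rw [this, S.bisum_sub]
  abel

/-- The normally ordered first order operator with given coefficients. -/
def op (m : M) : (G →₀ MvPolynomial I ℂ) →ₗ[ℂ] Module.End ℂ V :=
  Finsupp.lsum ℂ fun g => S.smear (S.gen g) m

@[simp] lemma op_single (m : M) (g : G) (f : MvPolynomial I ℂ) :
    S.op m (Finsupp.single g f) = S.smear (S.gen g) m f := by
  simp [op]

/-- The vector field attached to a first order operator. -/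
def vec : (G →₀ MvPolynomial I ℂ) →ₗ[MvPolynomial I ℂ]
    Derivation ℂ (MvPolynomial I ℂ) (MvPolynomial I ℂ) :=
  Finsupp.linearCombination _ S.der

/-- The symmetric bilinear form on first order operators. -/
def bil : (G →₀ MvPolynomial I ℂ) →ₗ[MvPolynomial I ℂ] (G →₀ MvPolynomial I ℂ) →ₗ[MvPolynomial I ℂ]
    MvPolynomial I ℂ :=
  Finsupp.linearCombination _ fun g => Finsupp.linearCombination _ fun h =>
    MvPolynomial.C (S.form g h)

lemma op_eq_sum (m : M) (X : G →₀ MvPolynomial I ℂ) (s : Finset G) (hs : X.support ⊆ s) (w : V) :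
    S.op m X w = ∑ g ∈ s, S.smear (S.gen g) m (X g) w := by
  rw [op, Finsupp.lsum_apply, Finsupp.sum_of_support_subset _ hs _ (by simp), LinearMap.sum_apply]

lemma vec_eq_sum (X : G →₀ MvPolynomial I ℂ) (s : Finset G) (hs : X.support ⊆ s)
    (f : MvPolynomial I ℂ) : S.vec X f = ∑ g ∈ s, S.der g f * X g := by
  rw [vec, Finsupp.linearCombination_apply, Finsupp.sum_of_support_subset _ hs _ (by simp)]
  rw [← Derivation.coeFnAddMonoidHom_apply, map_sum, Finset.sum_apply]
  simp [mul_comm]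

lemma op_comm (m k : M) (X Y : G →₀ MvPolynomial I ℂ) (s : Finset G) (hX : X.support ⊆ s)
    (hY : Y.support ⊆ s) (h : ∀ g, S.vec Y (X g) = S.vec X (Y g)) (w : V) :
    S.op m X (S.op k Y w) - S.op k Y (S.op m X w) =
      ∑ g ∈ s, ∑ h ∈ s,
        S.form g h • S.bisum (fun p q => S.cocycle (m - p) (k - q) • 1) (X g) (Y h) w := by
  have e1 : S.op m X (S.op k Y w) = ∑ g ∈ s, ∑ h ∈ s,
      S.smear (S.gen g) m (X g) (S.smear (S.gen h) k (Y h) w) := by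
    simp_rw [S.op_eq_sum _ X s hX, S.op_eq_sum _ Y s hY, map_sum]
  have e2 : S.op k Y (S.op m X w) = ∑ g ∈ s, ∑ h ∈ s,
      S.smear (S.gen h) k (Y h) (S.smear (S.gen g) m (X g) w) := by
    rw [Finset.sum_comm]
    simp_rw [S.op_eq_sum _ X s hX, S.op_eq_sum _ Y s hY, map_sum]
  rw [e1, e2, ← Finset.sum_sub_distrib]
  simp_rw [← Finset.sum_sub_distrib, smear_comm, Finset.sum_add_distrib, Finset.sum_sub_distrib]
  have e3 : ∑ g ∈ s, ∑ h ∈ s, S.smear (S.gen g) (m + k) (S.der h (X g) * Y h) w =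
      ∑ g ∈ s, S.smear (S.gen g) (m + k) (S.vec Y (X g)) w := by
    refine Finset.sum_congr rfl fun g _ => ?_
    rw [S.vec_eq_sum Y s hY, map_sum, LinearMap.sum_apply]
  have e4 : ∑ g ∈ s, ∑ h ∈ s, S.smear (S.gen h) (m + k) (S.der g (Y h) * X g) w =
      ∑ g ∈ s, S.smear (S.gen g) (m + k) (S.vec X (Y g)) w := by
    rw [Finset.sum_comm]
    refine Finset.sum_congr rfl fun g _ => ?_
    rw [S.vec_eq_sum X s hX, map_sum, LinearMap.sum_apply]
  rw [e3, e4]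
  simp_rw [h]
  abel

/-- First order operators with commuting vector fields and disjoint contractions commute. -/
theorem op_comm_of_form_eq_zero (m k : M) (X Y : G →₀ MvPolynomial I ℂ)
    (h : ∀ g, S.vec Y (X g) = S.vec X (Y g))
    (h0 : ∀ g h, X g ≠ 0 → Y h ≠ 0 → S.form g h = 0) (w : V) :
    S.op m X (S.op k Y w) - S.op k Y (S.op m X w) = 0 := by
  classical
  rw [S.op_comm m k X Y _ Finset.subset_union_left Finset.subset_union_right h]
  refine Finset.sum_eq_zero fun g _ => Finset.sum_eq_zero fun h _ => ?_
  by_cases hX : X g = 0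
  · simp [hX, CommutingFields.bisum, S.mode_zero]
  by_cases hY : Y h = 0
  · simp [hY, CommutingFields.bisum, S.mode_zero]
  rw [h0 g h hX hY, zero_smul]

/-- The modes of an isotropic first order operator commute with each other. -/
theorem op_comm_self (m k : M) (X : G →₀ MvPolynomial I ℂ) (h : S.bil X X = 0) (w : V) :
    S.op m X (S.op k X w) - S.op k X (S.op m X w) = 0 := by
  rw [S.op_comm m k X X _ subset_rfl subset_rfl (fun _ => rfl)]
  set B := fun g h => S.bisum (fun p q => S.cocycle (m - p) (k - q) • 1) (X g) (X h) w with hB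
  have hsymm : ∀ g h, B g h + B h g =
      S.smear (fun u => S.symmCocycle m k (-u) • 1) 0 (X g * X h) w := by
    intro g h
    rw [hB]
    dsimp only
    rw [S.bisum_comm _ (X h) (X g), ← S.bisum_add, S.smear_apply,
      ← S.bisum_total (fun u => S.symmCocycle m k (-(0 - u)) • 1)]
    congr 1
    ext p q
    simp [← S.cocycle_symm, add_smul]
  have h2 : (2 : ℂ) • ∑ g ∈ X.support, ∑ h ∈ X.support, S.form g h • B g h = 0 := by
    have : ∑ g ∈ X.support, ∑ h ∈ X.support, S.form g h • B g h =
        ∑ g ∈ X.support, ∑ h ∈ X.support, S.form g h • B h g := by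
      rw [Finset.sum_comm]
      refine Finset.sum_congr rfl fun g _ => Finset.sum_congr rfl fun h _ => ?_
      rw [S.form_symm]
    rw [two_smul]
    nth_rw 2 [this]
    have hb : S.bil X X = ∑ g ∈ X.support, ∑ h ∈ X.support, S.form g h • (X g * X h) := by
      simp only [bil, Finsupp.linearCombination_apply, Finsupp.sum, LinearMap.sum_apply,
        LinearMap.smul_apply, Finset.mul_sum, smul_eq_mul, MvPolynomial.smul_eq_C_mul]
      refine Finset.sum_congr rfl fun g _ => Finset.sum_congr rfl fun h _ => ?_
      ring
    calc _ = S.smear (fun u => S.symmCocycle m k (-u) • 1) 0 (S.bil X X) w := by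
          simp_rw [← Finset.sum_add_distrib, ← smul_add, hsymm, hb, map_sum, map_smul,
            LinearMap.sum_apply, LinearMap.smul_apply]
      _ = 0 := by rw [h, map_zero, LinearMap.zero_apply]
  exact (smul_eq_zero_iff_right two_ne_zero).1 h2

end FreeFields

end FirstOrder

section Heisenberg

variable {σ ι : Type*}

/-- A constant coefficient derivation plus a multiplication operator. -/
def heis (η : σ → ℂ) (ℓ : MvPolynomial σ ℂ) : Module.End ℂ (MvPolynomial σ ℂ) :=
  (MvPolynomial.mkDerivation ℂ fun i => MvPolynomial.C (η i) :
    Derivation ℂ (MvPolynomial σ ℂ) (MvPolynomial σ ℂ)).toLinearMap + LinearMap.mulLeft ℂ ℓ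

lemma heis_apply (η : σ → ℂ) (ℓ w : MvPolynomial σ ℂ) :
    heis η ℓ w = MvPolynomial.mkDerivation ℂ (fun i => MvPolynomial.C (η i)) w + ℓ * w := rfl

lemma mkDerivation_C_comm (η η' : σ → ℂ) (w : MvPolynomial σ ℂ) :
    MvPolynomial.mkDerivation ℂ (fun i => (MvPolynomial.C (η i) : MvPolynomial σ ℂ))
        (MvPolynomial.mkDerivation ℂ (fun i => MvPolynomial.C (η' i)) w) =
      MvPolynomial.mkDerivation ℂ (fun i => (MvPolynomial.C (η' i) : MvPolynomial σ ℂ))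
        (MvPolynomial.mkDerivation ℂ (fun i => MvPolynomial.C (η i)) w) := by
  set D : Derivation ℂ (MvPolynomial σ ℂ) (MvPolynomial σ ℂ) :=
    MvPolynomial.mkDerivation ℂ (fun i => MvPolynomial.C (η i)) with hD
  set D' : Derivation ℂ (MvPolynomial σ ℂ) (MvPolynomial σ ℂ) :=
    MvPolynomial.mkDerivation ℂ (fun i => MvPolynomial.C (η' i)) with hD'
  have : ⁅D, D'⁆ = 0 := by
    refine MvPolynomial.derivation_ext fun i => ?_
    rw [Derivation.commutator_apply, hD, hD', MvPolynomial.mkDerivation_X,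
      MvPolynomial.mkDerivation_X, MvPolynomial.derivation_C, MvPolynomial.derivation_C]
    simp
  have h := DFunLike.congr_fun this w
  rw [Derivation.commutator_apply] at h
  exact sub_eq_zero.1 h

lemma heis_comm (η η' : σ → ℂ) (ℓ ℓ' : MvPolynomial σ ℂ) :
    heis η ℓ * heis η' ℓ' - heis η' ℓ' * heis η ℓ =
      LinearMap.mulLeft ℂ (MvPolynomial.mkDerivation ℂ (fun i => MvPolynomial.C (η i)) ℓ' -
        MvPolynomial.mkDerivation ℂ (fun i => MvPolynomial.C (η' i)) ℓ) := by
  refine LinearMap.ext fun w => ?_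
  simp only [LinearMap.sub_apply, Module.End.mul_apply, heis_apply, map_add, Derivation.leibniz,
    smul_eq_mul, LinearMap.mulLeft_apply, mkDerivation_C_comm η η' w]
  ring

lemma finite_support_derivation
    {D : ι → Derivation ℂ (MvPolynomial σ ℂ) (MvPolynomial σ ℂ)}
    (h : ∀ i, (Function.support fun m => D m (MvPolynomial.X i)).Finite) (w : MvPolynomial σ ℂ) :
    (Function.support fun m => D m w).Finite := by
  induction w using MvPolynomial.induction_on with
  | C a => simp
  | add p q hp hq =>
    refine (hp.union hq).subset ?_
    simp only [map_add]
    exact Function.support_add _ _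
  | mul_X p i hp =>
    refine (hp.union (h i)).subset fun m hm => ?_
    simp only [Derivation.leibniz, Function.mem_support, Set.mem_union, smul_eq_mul] at hm ⊢
    by_contra! h0
    exact hm (by rw [h0.1, h0.2]; simp)

lemma finsum_derivation {D : ι → Derivation ℂ (MvPolynomial σ ℂ) (MvPolynomial σ ℂ)}
    (h : ∀ i, (Function.support fun m => D m (MvPolynomial.X i)).Finite) {η : σ → ℂ}
    (hη : ∀ i, ∑ᶠ m, D m (MvPolynomial.X i) = MvPolynomial.C (η i)) (w : MvPolynomial σ ℂ) :
    ∑ᶠ m, D m w = heis η 0 w := by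
  rw [heis_apply, zero_mul, add_zero]
  induction w using MvPolynomial.induction_on with
  | C a => simp
  | add p q hp hq =>
    simp only [map_add]
    rw [finsum_add_distrib (finite_support_derivation h p) (finite_support_derivation h q), hp, hq]
  | mul_X p i hp =>
    simp only [Derivation.leibniz, MvPolynomial.mkDerivation_X]
    rw [finsum_add_distrib, ← smul_finsum, ← smul_finsum, hp, hη]
    · exact (h i).subset fun m hm => by
        simp only [Function.mem_support] at hm ⊢
        exact fun h0 => hm (by rw [h0, smul_zero])
    · exact (finite_support_derivation h p).subset fun m hm => by
        simp only [Function.mem_support] at hm ⊢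
        exact fun h0 => hm (by rw [h0, smul_zero])

end Heisenberg

section Fields

variable {n N : ℕ} {pos : MM N → Prop}

/-- The variable `x_p(m)`, or `0` for an index pair out of range. -/
def xVar (n : ℕ) (pos : MM N → Prop) (p : ℕ × ℕ) (m : MM N) : Fock n N pos :=
  if h : 1 ≤ p.1 ∧ p.1 < p.2 ∧ p.2 ≤ n + 1 then MvPolynomial.X (Sum.inl (⟨p, h⟩, m)) else 0

open Classical in
/-- The variable `y_i(m)`, or `0` for an index out of range. -/
def yVar (n : ℕ) (pos : MM N → Prop) (i : ℕ) (m : MM N) : Fock n N pos :=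
  if h : (1 ≤ i ∧ i ≤ n) ∧ pos m then MvPolynomial.X (Sum.inr (⟨i, h.1⟩, ⟨m, h.2⟩)) else 0

/-- The functional on variables with value `c u` at `x_p(u)`. -/
def xDual (c : MM N → ℂ) (p : ℕ × ℕ) : XIdx n N ⊕ YIdx n N pos → ℂ
  | .inl x => if x.1.1 = p then c x.2 else 0
  | .inr _ => 0

/-- The functional on variables with value `c i s` at `y_i(s)`. -/
def yDual (c : ℕ → MM N → ℂ) : XIdx n N ⊕ YIdx n N pos → ℂ
  | .inl _ => 0
  | .inr y => c y.1.1 y.2.1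

/-- The constant coefficient derivation of the Fock space with given values on variables. -/
abbrev cder (η : XIdx n N ⊕ YIdx n N pos → ℂ) : Derivation ℂ (Fock n N pos) (Fock n N pos) :=
  MvPolynomial.mkDerivation ℂ fun i => MvPolynomial.C (η i)

@[simp] lemma cder_xDual_xVar (c : MM N → ℂ) (p q : ℕ × ℕ) (m : MM N) :
    cder (xDual c p) (xVar n pos q m) =
      MvPolynomial.C (if (1 ≤ q.1 ∧ q.1 < q.2 ∧ q.2 ≤ n + 1) ∧ q = p then c m else 0) := by
  unfold xVar
  split_ifs with h1 h2 h2
  · rw [MvPolynomial.mkDerivation_X]; simp [xDual, h2.2]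
  · have h3 : q ≠ p := fun h => h2 ⟨h1, h⟩
    rw [MvPolynomial.mkDerivation_X]; simp [xDual, h3]
  · exact absurd h2.1 h1
  · simp

@[simp] lemma cder_xDual_yVar (c : MM N → ℂ) (p : ℕ × ℕ) (i : ℕ) (m : MM N) :
    cder (xDual c p) (yVar n pos i m) = 0 := by
  unfold yVar
  split_ifs with h1
  · rw [MvPolynomial.mkDerivation_X]; simp [xDual]
  · simp

@[simp] lemma cder_yDual_xVar (c : ℕ → MM N → ℂ) (q : ℕ × ℕ) (m : MM N) :
    cder (yDual c) (xVar n pos q m) = 0 := by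
  unfold xVar
  split_ifs with h1
  · rw [MvPolynomial.mkDerivation_X]; simp [yDual]
  · simp

open Classical in
@[simp] lemma cder_yDual_yVar (c : ℕ → MM N → ℂ) (i : ℕ) (m : MM N) :
    cder (yDual c) (yVar n pos i m) =
      MvPolynomial.C (if (1 ≤ i ∧ i ≤ n) ∧ pos m then c i m else 0) := by
  unfold yVar
  split_ifs with h1
  · rw [MvPolynomial.mkDerivation_X]; simp [yDual]
  · simp

@[simp] lemma cder_zero (w : Fock n N pos) : cder (fun _ => 0) w = 0 := by
  have : cder (n := n) (N := N) (pos := pos) (fun _ => 0) = 0 :=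
    MvPolynomial.derivation_ext fun i => by simp
  simp [this]

lemma aop_eq (i j : ℕ) (m : MM N) (w : Fock n N pos) :
    aop n N pos i j m w = heis (fun _ => 0) (-xVar n pos (i, j) m) w := by
  rw [heis_apply, cder_zero]
  unfold aop xVar
  split_ifs with h <;> simp

lemma astar_eq (i j : ℕ) (m : MM N) (w : Fock n N pos) :
    astar n N pos i j m w = heis (xDual (fun u => if u = -m then 1 else 0) (i, j)) 0 w := by
  rw [heis_apply, zero_mul, add_zero]
  by_cases h : 1 ≤ i ∧ i < j ∧ j ≤ n + 1
  · refine (dif_pos h : astar n N pos i j m w = _).trans ?_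
    have : (MvPolynomial.pderiv (Sum.inl ((⟨(i, j), h⟩, -m) : XIdx n N)) :
        Derivation ℂ (Fock n N pos) (Fock n N pos)) =
        cder (xDual (fun u => if u = -m then 1 else 0) (i, j)) := by
      refine MvPolynomial.derivation_ext fun k => ?_
      classical
      rw [MvPolynomial.pderiv_X, MvPolynomial.mkDerivation_X]
      rcases k with ⟨⟨p, hp⟩, u⟩ | y
      · by_cases h1 : p = (i, j)
        · subst h1
          by_cases h2 : u = -m
          · subst h2; simp [xDual]
          · rw [Pi.single_eq_of_ne]
            · simp [xDual, h2]
            · intro h3; exact h2 (Prod.ext_iff.1 (Sum.inl.inj h3)).2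
        · rw [Pi.single_eq_of_ne]
          · simp [xDual, h1]
          · intro h3
            exact h1 (congrArg Subtype.val (Prod.ext_iff.1 (Sum.inl.inj h3)).1)
      · rw [Pi.single_eq_of_ne (by simp)]
        simp [xDual]
    exact DFunLike.congr_fun this w
  · refine (dif_neg h : astar n N pos i j m w = 0).trans ?_
    have : cder (n := n) (N := N) (pos := pos)
        (xDual (fun u => if u = -m then 1 else 0) (i, j)) = 0 := by
      refine MvPolynomial.derivation_ext fun k => ?_
      rw [MvPolynomial.mkDerivation_X]
      rcases k with ⟨⟨p, hp⟩, u⟩ | y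
      · have : p ≠ (i, j) := by rintro rfl; exact h hp
        simp [xDual, this]
      · simp [xDual]
    exact (DFunLike.congr_fun this w).symm

lemma ydot_eq (i : ℕ) (s : MM N) (w : Fock n N pos) :
    ydot n N pos i s w = cder (yDual fun j u => if j = i ∧ u = s then 1 else 0) w := by
  by_cases h : (1 ≤ i ∧ i ≤ n) ∧ pos s
  · refine (dif_pos h : ydot n N pos i s w = _).trans ?_
    have : (MvPolynomial.pderiv (Sum.inr ((⟨i, h.1⟩, ⟨s, h.2⟩) : YIdx n N pos)) :
        Derivation ℂ (Fock n N pos) (Fock n N pos)) =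
        cder (yDual fun j u => if j = i ∧ u = s then 1 else 0) := by
      refine MvPolynomial.derivation_ext fun k => ?_
      classical
      rw [MvPolynomial.pderiv_X, MvPolynomial.mkDerivation_X]
      rcases k with x | ⟨⟨j, hj⟩, ⟨u, hu⟩⟩
      · rw [Pi.single_eq_of_ne (by simp)]
        simp [yDual]
      · by_cases h1 : j = i
        · subst h1
          by_cases h2 : u = s
          · subst h2; simp [yDual]
          · rw [Pi.single_eq_of_ne]
            · simp [yDual, h2]
            · intro h3; exact h2 (congrArg Subtype.val (Prod.ext_iff.1 (Sum.inr.inj h3)).2)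
        · rw [Pi.single_eq_of_ne]
          · simp [yDual, h1]
          · intro h3
            exact h1 (congrArg Subtype.val (Prod.ext_iff.1 (Sum.inr.inj h3)).1)
    exact DFunLike.congr_fun this w
  · refine (dif_neg h : ydot n N pos i s w = 0).trans ?_
    have : cder (n := n) (N := N) (pos := pos)
        (yDual fun j u => if j = i ∧ u = s then 1 else 0) = 0 := by
      refine MvPolynomial.derivation_ext fun k => ?_
      rw [MvPolynomial.mkDerivation_X]
      rcases k with x | ⟨⟨j, hj⟩, ⟨u, hu⟩⟩
      · simp [yDual]
      · have : ¬(j = i ∧ u = s) := by rintro ⟨rfl, rfl⟩; exact h ⟨hj, hu⟩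
        simp [yDual, this]
    rw [this]; simp

lemma finsum_yDual (a : MM N → ℂ) (b : ℕ → ℂ) (w : Fock n N pos) :
    ∑ᶠ s, a s • cder (yDual fun j u => if u = s then b j else 0) w =
      cder (yDual fun j u => a u * b j) w := by
  have key : ∀ i : XIdx n N ⊕ YIdx n N pos, ∀ s : MM N,
      (a s • cder (yDual fun j u => if u = s then b j else 0)) (MvPolynomial.X i : Fock n N pos) =
        match i with
        | .inl _ => 0
        | .inr y => if y.2.1 = s then MvPolynomial.C (a s * b y.1.1) else 0 := by
    intro i s
    rw [Derivation.smul_apply, MvPolynomial.mkDerivation_X]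
    rcases i with x | y
    · simp [yDual]
    · by_cases h : y.2.1 = s <;> simp [yDual, h, MvPolynomial.smul_eq_C_mul]
  have := finsum_derivation
    (D := fun s => a s • cder (n := n) (pos := pos) (yDual fun j u => if u = s then b j else 0))
    (η := yDual fun j u => a u * b j) ?_ ?_ w
  · rw [heis_apply, zero_mul, add_zero] at this
    exact this
  · intro i
    simp only [key]
    rcases i with x | y
    · simp
    · refine (Set.finite_singleton y.2.1).subset fun s hs => ?_
      by_contra h
      exact hs (if_neg fun h' => h h'.symm)
  · intro i
    simp only [key]
    rcases i with x | y
    · simp [yDual]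
    · simp only [yDual]
      rw [finsum_eq_single _ y.2.1]
      · simp
      · intro s hs; rw [if_neg fun h' => hs h'.symm]

lemma cder_add (η η' : XIdx n N ⊕ YIdx n N pos → ℂ) (w : Fock n N pos) :
    cder (η + η') w = cder η w + cder η' w := by
  have : cder (η + η') = cder η + cder η' := MvPolynomial.derivation_ext fun i => by simp
  simp [this]

lemma cder_smul (c : ℂ) (η : XIdx n N ⊕ YIdx n N pos → ℂ) (w : Fock n N pos) :
    cder (c • η) w = c • cder η w := by
  have : cder (c • η) = c • cder η :=
    MvPolynomial.derivation_ext fun i => by simp [MvPolynomial.smul_eq_C_mul]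
  simp [this]

/-- The coefficient of `∂/∂y_j(s)` in `Φ(b_i(m))`. -/
def phiCoef (pos : MM N → Prop) (kappa : MM N → Fin (N + 1) → ℂ) (i : ℕ) (m : MM N) (j : ℕ)
    (s : MM N) : ℂ :=
  theta pos (-m) * (cnum kappa m s * ((if j = i - 1 then 1 else 0) - (if j = i then 1 else 0)))
  + theta pos m * (cnum kappa m s * ((if j = i - 1 then 1 else 0) - 2 * (if j = i then 1 else 0)
      + (if j = i + 1 then 1 else 0)))

lemma Phi_eq (kappa : MM N → Fin (N + 1) → ℂ) (lam : ℕ → ℂ) (i : ℕ) (m : MM N)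
    (w : Fock n N pos) :
    Phi n N pos kappa lam i m w = heis (yDual (phiCoef pos kappa i m))
      (yVar n pos i (-m) - MvPolynomial.C (if m = 0 then lam i else 0)) w := by
  have h1 : ∀ s, ydot n N pos (i - 1) s w - ydot n N pos i s w =
      cder (yDual fun j u => if u = s then
        ((if j = i - 1 then 1 else 0) - (if j = i then 1 else 0)) else 0) w := by
    intro s
    rw [ydot_eq, ydot_eq, sub_eq_add_neg, ← neg_one_smul ℂ, ← cder_smul, ← cder_add]
    congr 2
    ext k
    rcases k with x | y
    · simp [yDual]
    · by_cases h : y.2.1 = s <;> simp [yDual, h]; ring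
  have h2 : ∀ s, ydot n N pos (i - 1) s w - (2 : ℂ) • ydot n N pos i s w
        + ydot n N pos (i + 1) s w =
      cder (yDual fun j u => if u = s then
        ((if j = i - 1 then 1 else 0) - 2 * (if j = i then 1 else 0)
          + (if j = i + 1 then 1 else 0)) else 0) w := by
    intro s
    rw [ydot_eq, ydot_eq, ydot_eq, sub_eq_add_neg, ← neg_smul, ← cder_smul, ← cder_add,
      ← cder_add]
    congr 2
    ext k
    rcases k with x | y
    · simp [yDual]
    · by_cases h : y.2.1 = s <;> simp [yDual, h]; ring
  have h3 : (yDual (phiCoef pos kappa i m) : XIdx n N ⊕ YIdx n N pos → ℂ) =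
      theta pos (-m) • (yDual fun j u => cnum kappa m u *
        ((if j = i - 1 then 1 else 0) - (if j = i then 1 else 0))) +
      theta pos m • (yDual fun j u => cnum kappa m u *
        ((if j = i - 1 then 1 else 0) - 2 * (if j = i then 1 else 0)
          + (if j = i + 1 then 1 else 0))) := by
    ext k
    rcases k with x | y
    · simp [yDual]
    · simp [yDual, phiCoef]
  unfold Phi
  simp only [h1, h2, finsum_yDual]
  rw [heis_apply, h3, cder_add, cder_smul, cder_smul, sub_mul, MvPolynomial.C_mul']
  unfold yVar
  split_ifs <;> simp <;> abel

lemma finite_support_astar (i j : ℕ) (w : Fock n N pos) :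
    (Function.support fun m => astar n N pos i j m w).Finite := by
  simp only [astar_eq, heis_apply, zero_mul, add_zero]
  refine finite_support_derivation (fun k => ?_) w
  simp only [MvPolynomial.mkDerivation_X]
  rcases k with ⟨p, u⟩ | y
  · refine (Set.finite_singleton (-u)).subset fun m hm => ?_
    by_contra h
    have : ¬ u = -m := fun h' => h (by rw [h']; simp)
    exact hm (by simp [xDual, this])
  · simp [xDual]

lemma kD_eq (kappa : MM N → Fin (N + 1) → ℂ) (i j : ℕ) (v : MM N) (w : Fock n N pos) :
    kD n N pos kappa i j v w =
      heis (xDual (fun u => ∑ p, kappa (-u - v) p * (u p : ℂ)) (i, j)) 0 w := by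
  unfold kD
  simp only [astar_eq]
  have key : ∀ k : XIdx n N ⊕ YIdx n N pos, ∀ q : MM N,
      ((∑ p, kappa (q - v) p * (-(q p : ℂ))) •
          cder (xDual (fun u => if u = -q then 1 else 0) (i, j)))
        (MvPolynomial.X k : Fock n N pos) =
        match k with
        | .inl x => if q = -x.2 then MvPolynomial.C
            (if x.1.1 = (i, j) then ∑ p, kappa (-x.2 - v) p * (x.2 p : ℂ) else 0) else 0
        | .inr _ => 0 := by
    intro k q
    rw [Derivation.smul_apply, MvPolynomial.mkDerivation_X]
    rcases k with ⟨p, u⟩ | y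
    · by_cases h : q = -u
      · subst h
        by_cases h' : p.1 = (i, j) <;> simp [xDual, h', MvPolynomial.smul_eq_C_mul]
      · have h' : ¬ u = -q := fun h' => h (by rw [h']; simp)
        simp [xDual, h, h']
    · simp [xDual]
  have := finsum_derivation
    (D := fun q : MM N => (∑ p, kappa (q - v) p * (-(q p : ℂ))) •
      cder (n := n) (pos := pos) (xDual (fun u => if u = -q then 1 else 0) (i, j)))
    (η := xDual (fun u => ∑ p, kappa (-u - v) p * (u p : ℂ)) (i, j)) ?_ ?_ w
  · rw [← this]
    refine finsum_congr fun q => ?_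
    rw [heis_apply, zero_mul, add_zero, Derivation.smul_apply]
  · intro k
    simp only [key]
    rcases k with x | y
    · refine (Set.finite_singleton (-x.2)).subset fun s hs => ?_
      by_contra h
      exact hs (if_neg fun h' => h h')
    · simp
  · intro k
    simp only [key]
    rcases k with x | y
    · simp only [xDual]
      rw [finsum_eq_single _ (-x.2)]
      · simp
      · intro s hs; rw [if_neg hs]
    · simp [xDual]

end Fields

section Concrete

variable {n N : ℕ} {pos : MM N → Prop}

/-- The range of the index pairs. -/
abbrev IsRoot (n : ℕ) (p : ℕ × ℕ) : Prop := 1 ≤ p.1 ∧ p.1 < p.2 ∧ p.2 ≤ n + 1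

/-- Labels for the families `a_p`, `Φ(b_r)` and `κ·D a*_p`. -/
inductive Gen
  | a (p : ℕ × ℕ)
  | b (r : ℕ)
  | d (p : ℕ × ℕ)

instance : DecidableEq Gen := Classical.decEq _

/-- The derivation part of a generating family. -/
def genDual (n : ℕ) (pos : MM N → Prop) (kappa : MM N → Fin (N + 1) → ℂ) :
    Gen → MM N → XIdx n N ⊕ YIdx n N pos → ℂ
  | .a _, _ => fun _ => 0
  | .b r, m => if 1 ≤ r ∧ r ≤ n then yDual (phiCoef pos kappa r m) else fun _ => 0
  | .d p, v => xDual (fun u => ∑ i, kappa (-u - v) i * (u i : ℂ)) p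

/-- The multiplication part of a generating family. -/
def genVar (n : ℕ) (pos : MM N → Prop) (lam : ℕ → ℂ) : Gen → MM N → Fock n N pos
  | .a p, m => -xVar n pos p m
  | .b r, m => if 1 ≤ r ∧ r ≤ n then
      yVar n pos r (-m) - MvPolynomial.C (if m = 0 then lam r else 0) else 0
  | .d _, _ => 0

/-- The contractions of the generating families with the fields `a*_p`. -/
def genEps (n : ℕ) : Gen → ℕ × ℕ → ℂ
  | .a q, p => if IsRoot n q ∧ q = p then 1 else 0
  | _, _ => 0

/-- The symmetric form on the generating families. -/
def genForm (n : ℕ) : Gen → Gen → ℂ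
  | .a p, .d q => if IsRoot n p ∧ p = q then 1 else 0
  | .d q, .a p => if IsRoot n p ∧ p = q then 1 else 0
  | .b r, .b s => if (1 ≤ r ∧ r ≤ n) ∧ (1 ≤ s ∧ s ≤ n) then
      (if r = s then -2 else if r + 1 = s ∨ s + 1 = r then 1 else 0) else 0
  | _, _ => 0

lemma mulLeft_C (c : ℂ) : LinearMap.mulLeft ℂ (MvPolynomial.C c : Fock n N pos) = c • 1 :=
  LinearMap.ext fun w => by simp [MvPolynomial.C_mul']

lemma cnum_antisymm {kappa : MM N → Fin (N + 1) → ℂ}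
    (hE1 : ∀ m : MM N, ∑ p : Fin (N + 1), (m p : ℂ) * kappa m p = 0) (u v : MM N) :
    cnum kappa v (-u) = -cnum kappa u (-v) := by
  rw [eq_neg_iff_add_eq_zero]
  have h := hE1 (-u + -v)
  unfold cnum
  rw [add_comm (-v) (-u), ← Finset.sum_add_distrib, ← neg_eq_zero, ← h, ← Finset.sum_neg_distrib]
  refine Finset.sum_congr rfl fun i _ => ?_
  simp
  ring

lemma phiCoef_comm (htri : ∀ a : MM N, pos a ∨ a = 0 ∨ pos (-a))
    (hdisj : ∀ a : MM N, pos a → ¬ pos (-a))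
    {kappa : MM N → Fin (N + 1) → ℂ}
    (hE1 : ∀ m : MM N, ∑ p : Fin (N + 1), (m p : ℂ) * kappa m p = 0)
    (hE2 : ∀ m k : MM N, pos m → pos k →
      ∑ p : Fin (N + 1), (m p : ℂ) * kappa (-m - k) p = 0) {r s : ℕ} (hr : 1 ≤ r) (hs : 1 ≤ s)
    (u v : MM N) :
    theta pos (-v) * phiCoef pos kappa r u s (-v) - theta pos (-u) * phiCoef pos kappa s v r (-u) =
      (if r = s then -2 else if r + 1 = s ∨ s + 1 = r then 1 else 0) * cnum kappa u (-v) := by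
  have e1 : s = r - 1 ↔ s + 1 = r := by omega
  have e2 : r = s - 1 ↔ r + 1 = s := by omega
  have e3 : s = r + 1 ↔ r + 1 = s := eq_comm
  have e4 : r = s + 1 ↔ s + 1 = r := eq_comm
  have e5 : s = r ↔ r = s := eq_comm
  have hp : ∀ a, pos a → theta pos a = 1 := fun a h => if_pos h
  have hn : ∀ a, ¬ pos a → theta pos a = 0 := fun a h => if_neg h
  have hu0 : u = 0 → cnum kappa u (-v) = 0 := by rintro rfl; simp [cnum]
  have hv0 : v = 0 → cnum kappa u (-v) = 0 := by
    rintro rfl; rw [← neg_eq_zero, ← cnum_antisymm hE1]; simp [cnum]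
  have hpp : pos u → pos v → cnum kappa u (-v) = 0 := fun h1 h2 => by
    have := hE2 u v h1 h2
    simpa [cnum, sub_eq_add_neg] using this
  unfold phiCoef
  rw [cnum_antisymm hE1 u v]
  simp only [e1, e2, e3, e4, e5]
  have fin : ∀ c : ℂ, (r = s ∧ ¬ r + 1 = s ∧ ¬ s + 1 = r) ∨ (¬ r = s ∧ r + 1 = s ∧ ¬ s + 1 = r) ∨
      (¬ r = s ∧ ¬ r + 1 = s ∧ s + 1 = r) ∨ (¬ r = s ∧ ¬ r + 1 = s ∧ ¬ s + 1 = r) := by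
    intro; omega
  rcases htri u with hu | hu | hu
  · have hu' := hdisj u hu
    rcases htri v with hv | hv | hv
    · rw [hpp hu hv]; simp
    · rw [hv0 hv]; simp
    · have hv' : ¬ pos v := fun h => hdisj v h hv
      rw [hp _ hu, hn _ hu', hp _ hv, hn _ hv']
      rcases fin 0 with ⟨h1, h2, h3⟩ | ⟨h1, h2, h3⟩ | ⟨h1, h2, h3⟩ | ⟨h1, h2, h3⟩ <;>
        simp only [h1, h2, h3] <;> norm_num; ring
  · rw [hu0 hu]; simp
  · have hu' : ¬ pos u := fun h => hdisj u h hu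
    rcases htri v with hv | hv | hv
    · have hv' := hdisj v hv
      rw [hp _ hu, hn _ hu', hp _ hv, hn _ hv']
      rcases fin 0 with ⟨h1, h2, h3⟩ | ⟨h1, h2, h3⟩ | ⟨h1, h2, h3⟩ | ⟨h1, h2, h3⟩ <;>
        simp only [h1, h2, h3] <;> norm_num; ring
    · rw [hv0 hv]; simp
    · have hv' : ¬ pos v := fun h => hdisj v h hv
      rw [hp _ hu, hn _ hu', hp _ hv, hn _ hv']
      rcases fin 0 with ⟨h1, h2, h3⟩ | ⟨h1, h2, h3⟩ | ⟨h1, h2, h3⟩ | ⟨h1, h2, h3⟩ <;>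
        simp only [h1, h2, h3] <;> norm_num; ring

@[simp] lemma mkDerivation_zero :
    (MvPolynomial.mkDerivation ℂ fun _ => 0 : Derivation ℂ (Fock n N pos) (Fock n N pos)) = 0 :=
  MvPolynomial.derivation_ext fun i => by simp

/-- The fields `a*_p` with the families `a_p`, `Φ(b_r)` and `κ·D a*_p`. -/
def fockFields (n : ℕ) (htri : ∀ a : MM N, pos a ∨ a = 0 ∨ pos (-a))
    (hdisj : ∀ a : MM N, pos a → ¬ pos (-a))
    (kappa : MM N → Fin (N + 1) → ℂ) (lam : ℕ → ℂ)
    (hE1 : ∀ m : MM N, ∑ p : Fin (N + 1), (m p : ℂ) * kappa m p = 0)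
    (hE2 : ∀ m k : MM N, pos m → pos k →
      ∑ p : Fin (N + 1), (m p : ℂ) * kappa (-m - k) p = 0) :
    FreeFields (MM N) (Fock n N pos) (ℕ × ℕ) Gen where
  gam p m := heis (xDual (fun u => if u = -m then 1 else 0) p) 0
  locFin p w := by
    simpa only [astar_eq] using finite_support_astar p.1 p.2 w
  commute p q m k := by
    rw [commute_iff_eq, ← sub_eq_zero, heis_comm]
    simp
  gen g m := heis (genDual n pos kappa g m) (genVar n pos lam g m)
  eps := genEps n
  gen_gam g p u v := by
    rw [heis_comm]
    rcases g with q | r | q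
    · simp only [genDual, genVar, genEps, map_zero, map_neg, cder_xDual_xVar, zero_sub, neg_neg,
        mulLeft_C, IsRoot, eq_neg_iff_add_eq_zero]
      by_cases h : (1 ≤ q.1 ∧ q.1 < q.2 ∧ q.2 ≤ n + 1) ∧ q = p
      · by_cases h' : u + v = 0 <;> simp [if_pos h, h']
      · simp [if_neg h]
    · simp only [genDual, genVar, genEps]
      split_ifs <;> simp
    · simp [genDual, genVar, genEps]
  form := genForm n
  cocycle u v := cnum kappa u (-v)
  gen_gen g h u v := by
    rw [heis_comm, ← mulLeft_C]
    congr 1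
    have hant := cnum_antisymm hE1 u v
    rcases g with p | r | p <;> rcases h with q | s | q
    · simp [genDual, genVar, genForm]
    · simp only [genDual, genVar, genForm]
      split_ifs <;> simp
    · simp only [genDual, genVar, genForm, map_zero, map_neg, cder_xDual_xVar, neg_neg,
        IsRoot, cnum, sub_eq_add_neg, mul_comm (kappa _ _), ite_mul, one_mul, zero_mul, zero_add]
    · simp only [genDual, genVar, genForm]
      split_ifs <;> simp
    · simp only [genDual, genVar, genForm]
      by_cases hr : 1 ≤ r ∧ r ≤ n
      · by_cases hs : 1 ≤ s ∧ s ≤ n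
        · simp only [if_pos hr, if_pos hs, if_pos (And.intro hr hs)]
          rw [← phiCoef_comm htri hdisj hE1 hE2 hr.1 hs.1]
          by_cases hv : pos (-v) <;> by_cases hu : pos (-u) <;> simp [theta, hr, hs, hu, hv]
        · simp [hs]
      · simp [hr]
    · simp only [genDual, genVar, genForm]
      split_ifs <;> simp
    · simp only [genDual, genVar, genForm, map_zero, map_neg, cder_xDual_xVar,
        IsRoot, sub_eq_add_neg, mul_comm (kappa _ _)]
      rw [eq_comm, neg_eq_iff_eq_neg] at hant
      rw [hant]
      simp only [cnum, mul_neg, ite_mul, one_mul, zero_mul]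
      split_ifs <;> simp
    · simp only [genDual, genVar, genForm]
      split_ifs <;> simp
    · simp [genDual, genVar, genForm]
  form_symm g h := by
    rcases g with p | r | p <;> rcases h with q | s | q <;> try rfl
    unfold genForm
    simp only [and_comm, eq_comm (a := r) (b := s), or_comm]
  symmCocycle m k s := ∑ i, (2 * (m i : ℂ) - s i) * kappa (s - m - k) i
  cocycle_symm m k p q := by
    unfold cnum
    rw [show -(m - p) + -(k - q) = p + q - m - k by abel,
      show -(m - q) + -(k - p) = p + q - m - k by abel, ← Finset.sum_add_distrib]
    refine Finset.sum_congr rfl fun i _ => ?_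
    simp
    ring

end Concrete

section Symbols

open MvPolynomial (X)

variable {n N : ℕ} {pos : MM N → Prop} {kappa : MM N → Fin (N + 1) → ℂ} {lam : ℕ → ℂ}

/-- The structure `S` consists of the families of operators on the Fock space. -/
structure IsFock (n : ℕ) (kappa : MM N → Fin (N + 1) → ℂ) (lam : ℕ → ℂ)
    (S : FreeFields (MM N) (Fock n N pos) (ℕ × ℕ) Gen) : Prop where
  astar_eq : ∀ i j m w, astar n N pos i j m w = S.gam (i, j) m w
  aop_eq : ∀ i j m w, aop n N pos i j m w = S.gen (.a (i, j)) m w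
  kD_eq : ∀ i j m w, kD n N pos kappa i j m w = S.gen (.d (i, j)) m w
  Phi_eq : ∀ r, 1 ≤ r → r ≤ n → ∀ m w, Phi n N pos kappa lam r m w = S.gen (.b r) m w
  eps_eq : S.eps = genEps n
  form_eq : S.form = genForm n

lemma isFock_fockFields (htri : ∀ a : MM N, pos a ∨ a = 0 ∨ pos (-a))
    (hdisj : ∀ a : MM N, pos a → ¬ pos (-a))
    (kappa : MM N → Fin (N + 1) → ℂ) (lam : ℕ → ℂ)
    (hE1 : ∀ m : MM N, ∑ p : Fin (N + 1), (m p : ℂ) * kappa m p = 0)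
    (hE2 : ∀ m k : MM N, pos m → pos k →
      ∑ p : Fin (N + 1), (m p : ℂ) * kappa (-m - k) p = 0) :
    IsFock n kappa lam (fockFields n htri hdisj kappa lam hE1 hE2) where
  astar_eq := astar_eq
  aop_eq := aop_eq
  kD_eq := kD_eq kappa
  Phi_eq r h1 h2 m w := by
    rw [Phi_eq]
    simp [fockFields, genDual, genVar, h1, h2]
  eps_eq := rfl
  form_eq := rfl

variable (S : FreeFields (MM N) (Fock n N pos) (ℕ × ℕ) Gen)

/-- The family `Y` consists of the modes of `f`. -/
def IsMode (Y : MM N → Fock n N pos → Fock n N pos) (f : MvPolynomial (ℕ × ℕ) ℂ) : Prop :=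
  ∀ m w, Y m w = S.mode f m w

/-- The family `Y` consists of the modes of the first order operator `T`. -/
def IsOp (Y : MM N → Fock n N pos → Fock n N pos) (T : Gen →₀ MvPolynomial (ℕ × ℕ) ℂ) : Prop :=
  ∀ m w, Y m w = S.op m T w

variable {S} {Y Z : MM N → Fock n N pos → Fock n N pos} {T U : Gen →₀ MvPolynomial (ℕ × ℕ) ℂ}
  {f e : MvPolynomial (ℕ × ℕ) ℂ} {g : Gen}

lemma IsMode.fmul (hY : IsMode S Y f) (hZ : IsMode S Z e) : IsMode S (fmul n N pos Y Z) (f * e) :=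
  fun m w => by
    rw [S.mode_mul]
    exact finsum_congr fun k => by rw [hY, hZ]

lemma IsOp.fmul (hY : IsOp S Y (.single g f)) (hZ : IsMode S Z e) :
    IsOp S (fmul n N pos Y Z) (.single g (f * e)) := fun m w => by
  rw [S.op_single, ← S.finsum_smear_mode]
  exact finsum_congr fun k => by rw [hY, hZ, S.op_single]

lemma IsMode.fmul_op (hg : S.eps g = 0) (hY : IsMode S Y f) (hZ : IsOp S Z (.single g e)) :
    IsOp S (Stmt15.fmul n N pos Y Z) (.single g (f * e)) := fun m w => by
  rw [S.op_single, ← S.finsum_mode_smear]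
  · exact finsum_congr fun k => by rw [hY, hZ, S.op_single]
  · intro i u p
    rw [commute_iff_eq, ← sub_eq_zero, S.gen_gam, hg]
    simp

lemma IsOp.add (hY : IsOp S Y T) (hZ : IsOp S Z U) : IsOp S (fun m => Y m + Z m) (T + U) :=
  fun m w => by simp [hY m w, hZ m w]

lemma IsOp.sub (hY : IsOp S Y T) (hZ : IsOp S Z U) : IsOp S (fun m => Y m - Z m) (T - U) :=
  fun m w => by simp [hY m w, hZ m w]

lemma IsOp.neg (hY : IsOp S Y T) : IsOp S (fun m => -Y m) (-T) :=
  fun m w => by simp [hY m w]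

lemma IsOp.zero : IsOp S (fun _ => 0) 0 := fun m w => by simp

lemma IsOp.ite {p : Prop} [Decidable p] (hY : p → IsOp S Y T) :
    IsOp S (fun m => if p then Y m else 0) (if p then T else 0) := by
  by_cases h : p
  · simpa [h] using hY h
  · simpa [h] using IsOp.zero

lemma IsOp.sum {ι : Type*} {s : Finset ι} {Y : ι → MM N → Fock n N pos → Fock n N pos}
    {T : ι → Gen →₀ MvPolynomial (ℕ × ℕ) ℂ} (h : ∀ i ∈ s, IsOp S (Y i) (T i)) :
    IsOp S (fun m => ∑ i ∈ s, Y i m) (∑ i ∈ s, T i) := fun m w => by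
  dsimp only
  rw [Finset.sum_apply, map_sum, LinearMap.sum_apply]
  exact Finset.sum_congr rfl fun i hi => h i hi m w

/-- The product of the fields attached to a list of pairs. -/
abbrev pathProd (l : List (ℕ × ℕ)) : MvPolynomial (ℕ × ℕ) ℂ := (l.map X).prod

namespace IsFock

variable (h : IsFock n kappa lam S)
include h

lemma astar (i j : ℕ) : IsMode S (astar n N pos i j) (X (i, j)) := fun m w => by
  rw [h.astar_eq, S.mode_X]

lemma aop (i j : ℕ) : IsOp S (aop n N pos i j) (.single (.a (i, j)) 1) := fun m w => by
  rw [h.aop_eq, S.op_single, S.smear_one]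

lemma kD (i j : ℕ) : IsOp S (kD n N pos kappa i j) (.single (.d (i, j)) 1) := fun m w => by
  rw [h.kD_eq, S.op_single, S.smear_one]

lemma Phi {r : ℕ} (h1 : 1 ≤ r) (h2 : r ≤ n) :
    IsOp S (Phi n N pos kappa lam r) (.single (.b r) 1) := fun m w => by
  rw [h.Phi_eq r h1 h2, S.op_single, S.smear_one]

lemma fprod_astar (l : List (ℕ × ℕ)) :
    IsMode S (fprod n N pos (l.map fun p => Stmt15.astar n N pos p.1 p.2)) (pathProd l) := by
  induction l with
  | nil => exact fun m w => (S.mode_one m w).symm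
  | cons p l ih => exact (h.astar p.1 p.2).fmul ih

lemma fprod_astar_op (l : List (ℕ × ℕ)) (hg : S.eps g = 0) (hY : IsOp S Y (.single g 1)) :
    IsOp S (fprod n N pos ((l.map fun p => Stmt15.astar n N pos p.1 p.2) ++ [Y]))
      (.single g (pathProd l)) := by
  induction l with
  | nil =>
    have := hY.fmul (h.fprod_astar [])
    rwa [one_mul] at this
  | cons p l ih => exact (h.astar p.1 p.2).fmul_op hg ih

lemma eps_b (r : ℕ) : S.eps (.b r) = 0 := by rw [h.eps_eq]; rfl

lemma eps_d (p : ℕ × ℕ) : S.eps (.d p) = 0 := by rw [h.eps_eq]; rfl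

end IsFock

/-- The symbol of `ρ(F_r)` for `r ≥ 1`. -/
def symF (r : ℕ) : Gen →₀ MvPolynomial (ℕ × ℕ) ℂ :=
  .single (.a (r, r + 1)) 1 - ∑ j ∈ Finset.Ico 1 r, .single (.a (j, r + 1)) (X (j, r))

/-- The symbol of `ρ(E_r)` for `r ≥ 1`. -/
def symE (n r : ℕ) : Gen →₀ MvPolynomial (ℕ × ℕ) ℂ :=
  .single (.a (r, r + 1)) (X (r, r + 1) * X (r, r + 1))
  - ∑ j ∈ Finset.Icc (r + 2) (n + 1), .single (.a (r + 1, j)) (X (r, j))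
  + ∑ j ∈ Finset.Ico 1 r, .single (.a (j, r)) (X (j, r + 1))
  + ∑ j ∈ Finset.Icc (r + 2) (n + 1), (.single (.a (r, j)) (X (r, j) * X (r, r + 1)) -
      .single (.a (r + 1, j)) (X (r + 1, j) * X (r, r + 1)))
  + .single (.b r) (X (r, r + 1))
  + .single (.d (r, r + 1)) 1

/-- The symbol of `ρ(E_0)`. -/
def symE0 (n : ℕ) : Gen →₀ MvPolynomial (ℕ × ℕ) ℂ := -.single (.a (1, n + 1)) 1

/-- The generating polynomial of the paths from `1` to `j`. -/
def pathP (n j : ℕ) : MvPolynomial (ℕ × ℕ) ℂ :=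
  ∑ s ∈ (Finset.Icc 2 (n + 1)).powerset, if qend s = j then pathProd (qpairs (ql s)) else 0

/-- The generating polynomial of the paths from `1` to `j` whose last step starts at most at `r`. -/
def pathV (n r j : ℕ) : MvPolynomial (ℕ × ℕ) ℂ :=
  ∑ s ∈ (Finset.Icc 2 (n + 1)).powerset,
    if r < j ∧ qend s = j ∧ qpen s ≤ r then pathProd (qpairs (ql s)) else 0

/-- The generating polynomial of the paths from `1` to `n + 1` whose last step starts at most at
`r`, parametrized by the path without its last step. -/
def pathG (n r : ℕ) : MvPolynomial (ℕ × ℕ) ℂ :=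
  ∑ s ∈ (Finset.Icc 2 (n + 1)).powerset,
    if qend s ≤ r then pathProd (qpairs (ql s ++ [n + 1])) else 0

/-- The symbol of `ρ(F_0)`. -/
def symF0 (n : ℕ) : Gen →₀ MvPolynomial (ℕ × ℕ) ℂ :=
  -(∑ r ∈ Finset.Icc 1 (n + 1), ∑ j ∈ Finset.Icc 1 (n + 1),
      .single (.a (r, j)) (pathV n r j * X (r, n + 1)))
  - ∑ r ∈ Finset.Icc 1 n, .single (.b r) (pathG n r)
  - ∑ r ∈ Finset.Icc 1 n, .single (.d (r, n + 1)) (pathP n r)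

namespace IsFock

variable (h : IsFock n kappa lam S)
include h

lemma rhoF (r : ℕ) : IsOp S (rhoF n N pos r) (symF r) := by
  refine (h.aop _ _).sub (.sum fun j _ => ?_)
  simpa using (h.aop j (r + 1)).fmul (h.astar j r)

lemma rhoEn {r : ℕ} (h1 : 1 ≤ r) (h2 : r ≤ n) :
    IsOp S (rhoEn n N pos kappa lam r) (symE n r) := by
  refine .add (.add (.add (.add (.sub ?_ (.sum fun j _ => ?_)) (.sum fun j _ => ?_))
    (.sum fun j _ => .sub ?_ ?_)) ?_) (h.kD r (r + 1))
  · simpa using (h.aop r (r + 1)).fmul ((h.astar r (r + 1)).fmul (h.astar r (r + 1)))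
  · simpa using (h.aop (r + 1) j).fmul (h.astar r j)
  · simpa using (h.aop j r).fmul (h.astar j (r + 1))
  · simpa using ((h.aop r j).fmul (h.astar r j)).fmul (h.astar r (r + 1))
  · simpa using ((h.aop (r + 1) j).fmul (h.astar (r + 1) j)).fmul (h.astar r (r + 1))
  · simpa using (h.astar r (r + 1)).fmul_op (h.eps_b r) (h.Phi h1 h2)

lemma rhoF0 : IsOp S (rhoF0 n N pos kappa lam) (symF0 n) := by
  have e1 : ∀ r j, (Finsupp.single (.a (r, j)) (pathV n r j * X (r, n + 1)) : Gen →₀ _) =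
      ∑ s ∈ (Finset.Icc 2 (n + 1)).powerset, if r < j ∧ qend s = j ∧ qpen s ≤ r then
        .single (.a (r, j)) (pathProd (qpairs (ql s)) * X (r, n + 1)) else 0 := by
    intro r j
    rw [pathV, Finset.sum_mul, Finsupp.single_finsetSum]
    refine Finset.sum_congr rfl fun s _ => ?_
    split_ifs <;> simp
  have e2 : ∀ r, (Finsupp.single (.b r) (pathG n r) : Gen →₀ _) =
      ∑ s ∈ (Finset.Icc 2 (n + 1)).powerset, if qend s ≤ r then
        .single (.b r) (pathProd (qpairs (ql s ++ [n + 1]))) else 0 := by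
    intro r
    rw [pathG, Finsupp.single_finsetSum]
    refine Finset.sum_congr rfl fun s _ => ?_
    split_ifs <;> simp
  have e3 : ∀ r, (Finsupp.single (.d (r, n + 1)) (pathP n r) : Gen →₀ _) =
      ∑ s ∈ (Finset.Icc 2 (n + 1)).powerset, if qend s = r then
        .single (.d (r, n + 1)) (pathProd (qpairs (ql s))) else 0 := by
    intro r
    rw [pathP, Finsupp.single_finsetSum]
    refine Finset.sum_congr rfl fun s _ => ?_
    split_ifs <;> simp
  unfold symF0
  simp only [e1, e2, e3]
  refine .sub (.sub (.neg (.sum fun r _ => .sum fun j _ => .sum fun s _ => .ite fun _ => ?_))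
    (.sum fun r hr => .sum fun s _ => .ite fun _ => ?_))
    (.sum fun r _ => .sum fun s _ => .ite fun _ => ?_)
  · have := h.fprod_astar (qpairs (ql s) ++ [(r, n + 1)])
    rw [List.map_append, pathProd, List.map_append, List.prod_append, List.map_singleton,
      List.map_singleton, List.prod_singleton] at this
    have := (h.aop r j).fmul this
    rw [one_mul] at this
    exact this
  · rw [Finset.mem_Icc] at hr
    exact h.fprod_astar_op _ (h.eps_b r) (h.Phi hr.1 hr.2)
  · exact h.fprod_astar_op _ (h.eps_d _) (h.kD r (n + 1))

end IsFock

end Symbols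

section Paths

open MvPolynomial (X)

lemma ql_insert {s : Finset ℕ} {j : ℕ} (h : ∀ i ∈ s, i < j) : ql (insert j s) = ql s ++ [j] := by
  have hj : j ∉ s := fun hj => lt_irrefl _ (h j hj)
  unfold ql
  rw [List.cons_append]
  congr 1
  refine List.Perm.eq_of_pairwise' (r := (· ≤ ·)) (Finset.pairwise_sort _ _) ?_ ?_
  · refine List.pairwise_append.2 ⟨Finset.pairwise_sort _ _, List.pairwise_singleton _ _, ?_⟩
    intro a ha b hb
    rw [List.mem_singleton.1 hb]
    exact (h a ((Finset.mem_sort _).1 ha)).le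
  · rw [List.perm_ext_iff_of_nodup (Finset.sort_nodup _ _)]
    · simp [or_comm]
    · refine List.nodup_append.2 ⟨Finset.sort_nodup _ _, List.nodup_singleton _, ?_⟩
      intro a ha b hb hab
      rw [List.mem_singleton.1 hb] at hab
      exact hj (hab ▸ (Finset.mem_sort _).1 ha)

lemma qend_insert {s : Finset ℕ} {j : ℕ} (h : ∀ i ∈ s, i < j) : qend (insert j s) = j := by
  rw [qend, ql_insert h]
  simp

lemma qpen_insert {s : Finset ℕ} {j : ℕ} (h : ∀ i ∈ s, i < j) : qpen (insert j s) = qend s := by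
  rw [qpen, ql_insert h, qend]
  simp

lemma qpairs_append_singleton (a : ℕ) (l : List ℕ) (j : ℕ) :
    qpairs (a :: l ++ [j]) = qpairs (a :: l) ++ [(((a :: l).getLast?).getD 0, j)] := by
  induction l generalizing a with
  | nil => simp [qpairs]
  | cons b l ih =>
    have : ∀ l, qpairs (a :: b :: l) = (a, b) :: qpairs (b :: l) := fun l => rfl
    rw [List.cons_append, List.cons_append, this, this, ← List.cons_append, ih]
    simp

lemma pathProd_append (s : Finset ℕ) (j : ℕ) :
    pathProd (qpairs (ql s ++ [j])) = pathProd (qpairs (ql s)) * X (qend s, j) := by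
  rw [ql, qpairs_append_singleton, pathProd, List.map_append, List.prod_append]
  simp [qend, ql]

lemma qend_empty : qend ∅ = 1 := by simp [qend, ql]

lemma qend_eq_max' {s : Finset ℕ} (h : s.Nonempty) : qend s = s.max' h := by
  conv_lhs => rw [← Finset.insert_erase (s.max'_mem h)]
  refine qend_insert fun i hi => ?_
  exact lt_of_le_of_ne (s.le_max' i (Finset.mem_of_mem_erase hi)) (Finset.ne_of_mem_erase hi)

lemma le_qend {s : Finset ℕ} {i : ℕ} (hi : i ∈ s) : i ≤ qend s := by
  rw [qend_eq_max' ⟨i, hi⟩]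
  exact s.le_max' i hi

lemma qend_mem {s : Finset ℕ} (h : s.Nonempty) : qend s ∈ s := by
  rw [qend_eq_max' h]
  exact s.max'_mem h

lemma qend_mem_Icc {s : Finset ℕ} {m : ℕ} (hm : 1 ≤ m) (h : s ⊆ Finset.Icc 2 m) :
    qend s ∈ Finset.Icc 1 m := by
  rcases s.eq_empty_or_nonempty with rfl | hs
  · simpa [qend_empty] using hm
  · have := Finset.mem_Icc.1 (h (qend_mem hs))
    exact Finset.mem_Icc.2 ⟨by omega, this.2⟩

lemma sum_ite_qend {R : Type*} [AddCommMonoid R] {n j : ℕ} (hj : 2 ≤ j) (hjn : j ≤ n + 1)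
    (F : Finset ℕ → R) :
    (∑ s ∈ (Finset.Icc 2 (n + 1)).powerset, if qend s = j then F s else 0) =
      ∑ s ∈ (Finset.Icc 2 (j - 1)).powerset, F (insert j s) := by
  have hlt : ∀ s ∈ (Finset.Icc 2 (j - 1)).powerset, ∀ i ∈ s, i < j := fun s hs i hi => by
    have := Finset.mem_Icc.1 (Finset.mem_powerset.1 hs hi)
    omega
  rw [← Finset.sum_filter]
  symm
  refine Finset.sum_bij (fun s _ => insert j s) (fun s hs => ?_) (fun s hs t ht h => ?_)
    (fun t ht => ?_) (fun _ _ => rfl)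
  · refine Finset.mem_filter.2 ⟨Finset.mem_powerset.2 ?_, qend_insert (hlt s hs)⟩
    refine Finset.insert_subset (Finset.mem_Icc.2 ⟨hj, hjn⟩) ?_
    exact (Finset.mem_powerset.1 hs).trans (Finset.Icc_subset_Icc le_rfl (by omega))
  · have hs' : j ∉ s := fun h => lt_irrefl _ (hlt s hs j h)
    have ht' : j ∉ t := fun h => lt_irrefl _ (hlt t ht j h)
    rw [← Finset.erase_insert hs', ← Finset.erase_insert ht', h]
  · obtain ⟨h1, h2⟩ := Finset.mem_filter.1 ht
    have hne : t.Nonempty := by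
      rw [Finset.nonempty_iff_ne_empty]
      rintro rfl
      rw [qend_empty] at h2
      omega
    refine ⟨t.erase j, Finset.mem_powerset.2 fun i hi => ?_,
      Finset.insert_erase (h2 ▸ qend_mem hne)⟩
    have h3 := le_qend (Finset.mem_of_mem_erase hi)
    have h4 := Finset.ne_of_mem_erase hi
    have h5 := Finset.mem_Icc.1 (Finset.mem_powerset.1 h1 (Finset.mem_of_mem_erase hi))
    exact Finset.mem_Icc.2 ⟨h5.1, by omega⟩

lemma sum_pathP_mul {n r : ℕ} (j : ℕ) :
    (∑ s ∈ (Finset.Icc 2 (n + 1)).powerset,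
      if qend s ≤ r then pathProd (qpairs (ql s)) * X (qend s, j) else 0) =
      ∑ k ∈ Finset.Icc 1 r, pathP n k * X (k, j) := by
  simp only [pathP, Finset.sum_mul, ite_mul, zero_mul]
  rw [Finset.sum_comm]
  refine Finset.sum_congr rfl fun s hs => ?_
  have h1 := (Finset.mem_Icc.1 (qend_mem_Icc (by omega) (Finset.mem_powerset.1 hs))).1
  rw [Finset.sum_ite_eq]
  simp [h1]

lemma pathG_eq (n r : ℕ) : pathG n r = ∑ k ∈ Finset.Icc 1 r, pathP n k * X (k, n + 1) := by
  rw [← sum_pathP_mul, pathG]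
  simp only [pathProd_append]

lemma pathV_eq_sum_ite {n r j : ℕ} (hrj : r < j) :
    pathV n r j = ∑ s ∈ (Finset.Icc 2 (n + 1)).powerset,
      if qend s = j then (if qpen s ≤ r then pathProd (qpairs (ql s)) else 0) else 0 := by
  refine Finset.sum_congr rfl fun s _ => ?_
  rw [← ite_and]
  simp [hrj]

lemma pathV_eq {n r j : ℕ} (hr : 1 ≤ r) (hrj : r < j) (hj : j ≤ n + 1) :
    pathV n r j = ∑ k ∈ Finset.Icc 1 r, pathP n k * X (k, j) := by
  have hlt : ∀ s ∈ (Finset.Icc 2 (j - 1)).powerset, ∀ i ∈ s, i < j := fun s hs i hi => by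
    have := Finset.mem_Icc.1 (Finset.mem_powerset.1 hs hi)
    omega
  rw [pathV_eq_sum_ite hrj, sum_ite_qend (by omega) hj, ← sum_pathP_mul]
  have h2 : (Finset.Icc 2 (j - 1)).powerset ⊆ (Finset.Icc 2 (n + 1)).powerset :=
    Finset.powerset_mono.2 (Finset.Icc_subset_Icc le_rfl (by omega))
  rw [← Finset.sum_subset h2]
  · refine Finset.sum_congr rfl fun s hs => ?_
    rw [qpen_insert (hlt s hs), ql_insert (hlt s hs), pathProd_append]
  · intro s hs hs'
    refine if_neg fun h => hs' (Finset.mem_powerset.2 fun i hi => ?_)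
    have h3 := le_qend hi
    have h4 := Finset.mem_Icc.1 (Finset.mem_powerset.1 hs hi)
    exact Finset.mem_Icc.2 ⟨h4.1, by omega⟩

lemma pathP_one (n : ℕ) : pathP n 1 = 1 := by
  rw [pathP, Finset.sum_eq_single ∅]
  · rw [qend_empty]
    simp [ql, qpairs, pathProd]
  · intro s hs hne
    refine if_neg fun h => ?_
    have h1 := Finset.mem_powerset.1 hs (qend_mem (Finset.nonempty_iff_ne_empty.2 hne))
    rw [h] at h1
    simp at h1
  · simp

lemma pathP_eq {n j : ℕ} (hj : 2 ≤ j) (hjn : j ≤ n + 1) : pathP n j = pathV n (j - 1) j := by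
  rw [pathP, sum_ite_qend hj hjn, pathV_eq_sum_ite (by omega), sum_ite_qend hj hjn]
  refine Finset.sum_congr rfl fun s hs => ?_
  have hs := Finset.mem_powerset.1 hs
  have h1 := Finset.mem_Icc.1 (qend_mem_Icc (by omega) hs)
  rw [qpen_insert, if_pos h1.2]
  intro i hi
  have := Finset.mem_Icc.1 (hs hi)
  omega

end Paths

section Coefficients

open MvPolynomial (X)

variable {n r s : ℕ}

lemma sum_single_a_left (s : Finset ℕ) (k : ℕ) (f : ℕ → MvPolynomial (ℕ × ℕ) ℂ) (i j : ℕ) :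
    (∑ l ∈ s, (Finsupp.single (.a (k, l)) (f l) : Gen →₀ _)) (.a (i, j)) =
      if i = k ∧ j ∈ s then f j else 0 := by
  rw [Finsupp.finsetSum_apply]
  simp only [Finsupp.single_apply, Gen.a.injEq, Prod.mk.injEq]
  by_cases h : k = i
  · simp [h]
  · simp [h, Ne.symm h]

lemma sum_single_a_right (s : Finset ℕ) (k : ℕ) (f : ℕ → MvPolynomial (ℕ × ℕ) ℂ) (i j : ℕ) :
    (∑ l ∈ s, (Finsupp.single (.a (l, k)) (f l) : Gen →₀ _)) (.a (i, j)) =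
      if j = k ∧ i ∈ s then f i else 0 := by
  rw [Finsupp.finsetSum_apply]
  simp only [Finsupp.single_apply, Gen.a.injEq, Prod.mk.injEq]
  by_cases h : k = j
  · simp [h]
  · simp [h, Ne.symm h]

lemma symF_a (r i j : ℕ) : symF r (.a (i, j)) =
    (if i = r ∧ j = r + 1 then 1 else 0) - if j = r + 1 ∧ 1 ≤ i ∧ i < r then X (i, r) else 0 := by
  rw [symF, Finsupp.sub_apply, sum_single_a_right]
  simp only [Finsupp.single_apply, Gen.a.injEq, Prod.mk.injEq, Finset.mem_Ico, eq_comm]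

@[simp] lemma symF_b (r k : ℕ) : symF r (.b k) = 0 := by
  simp [symF]

@[simp] lemma symF_d (r : ℕ) (p : ℕ × ℕ) : symF r (.d p) = 0 := by
  simp [symF]

lemma symE_a (n r i j : ℕ) : symE n r (.a (i, j)) =
    (if i = r ∧ j = r + 1 then X (r, r + 1) * X (r, r + 1) else 0)
    - (if i = r + 1 ∧ r + 2 ≤ j ∧ j ≤ n + 1 then X (r, j) else 0)
    + (if j = r ∧ 1 ≤ i ∧ i < r then X (i, r + 1) else 0)
    + ((if i = r ∧ r + 2 ≤ j ∧ j ≤ n + 1 then X (r, j) * X (r, r + 1) else 0)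
      - if i = r + 1 ∧ r + 2 ≤ j ∧ j ≤ n + 1 then X (r + 1, j) * X (r, r + 1) else 0) := by
  rw [symE, Finset.sum_sub_distrib]
  simp only [Finsupp.sub_apply, Finsupp.add_apply, sum_single_a_right, sum_single_a_left]
  simp [Finsupp.single_apply, @eq_comm _ r i, @eq_comm _ (r + 1) j]

lemma symE_b (n r k : ℕ) : symE n r (.b k) = if k = r then X (r, r + 1) else 0 := by
  simp [symE, Finsupp.single_apply, eq_comm]

lemma symE_d (n r : ℕ) (p : ℕ × ℕ) : symE n r (.d p) = if p = (r, r + 1) then 1 else 0 := by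
  simp [symE, Finsupp.single_apply, eq_comm]

lemma symE0_a (n : ℕ) (p : ℕ × ℕ) : symE0 n (.a p) = if p = (1, n + 1) then -1 else 0 := by
  simp only [symE0, Finsupp.neg_apply, Finsupp.single_apply, Gen.a.injEq, eq_comm]
  split_ifs <;> simp

@[simp] lemma symE0_b (n k : ℕ) : symE0 n (.b k) = 0 := by
  simp [symE0]

@[simp] lemma symE0_d (n : ℕ) (p : ℕ × ℕ) : symE0 n (.d p) = 0 := by
  simp [symE0]

lemma symF0_a (n i j : ℕ) : symF0 n (.a (i, j)) =
    if (1 ≤ i ∧ i ≤ n + 1) ∧ 1 ≤ j ∧ j ≤ n + 1 then -(pathV n i j * X (i, n + 1)) else 0 := by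
  simp only [symF0, Finsupp.sub_apply, Finsupp.neg_apply, Finsupp.finsetSum_apply]
  simp only [← Finsupp.finsetSum_apply, sum_single_a_left]
  by_cases h : (1 ≤ i ∧ i ≤ n + 1) ∧ 1 ≤ j ∧ j ≤ n + 1
  · simp [Finsupp.finsetSum_apply, h]
  · have (x : ℕ) (hx : x ∈ Finset.Icc 1 (n + 1)) :
        ¬(i = x ∧ j ∈ Finset.Icc 1 (n + 1)) := by
      rintro ⟨rfl, hj⟩
      exact h ⟨Finset.mem_Icc.1 hx, Finset.mem_Icc.1 hj⟩
    rw [if_neg h, Finset.sum_eq_zero fun x hx => if_neg (this x hx)]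
    simp [Finsupp.finsetSum_apply]

lemma symF0_b (n k : ℕ) : symF0 n (.b k) = if 1 ≤ k ∧ k ≤ n then -pathG n k else 0 := by
  simp only [symF0, Finsupp.sub_apply, Finsupp.neg_apply, Finsupp.finsetSum_apply,
    Finsupp.single_apply]
  simp only [reduceCtorEq, if_false, Finset.sum_const_zero, neg_zero, zero_sub, sub_zero,
    Gen.b.injEq, Finset.sum_ite_eq', Finset.mem_Icc]
  split_ifs <;> simp

lemma symF0_d (n : ℕ) (p : ℕ × ℕ) :
    symF0 n (.d p) = ∑ r ∈ Finset.Icc 1 n, if (r, n + 1) = p then -pathP n r else 0 := by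
  simp only [symF0, Finsupp.sub_apply, Finsupp.neg_apply, Finsupp.finsetSum_apply,
    Finsupp.single_apply, ← Finset.sum_neg_distrib, Gen.d.injEq, apply_ite]
  simp [← Finset.sum_neg_distrib, apply_ite]

end Coefficients

section Contractions

open MvPolynomial (X C)

variable {n N : ℕ} {pos : MM N → Prop} {kappa : MM N → Fin (N + 1) → ℂ} {lam : ℕ → ℂ}
  {S : FreeFields (MM N) (Fock n N pos) (ℕ × ℕ) Gen}

/-- The finite set of pairs `(i, j)` with `1 ≤ i < j ≤ n + 1`. -/
def roots (n : ℕ) : Finset (ℕ × ℕ) :=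
  (Finset.Icc 1 n ×ˢ Finset.Icc 1 (n + 1)).filter fun p => p.1 < p.2

lemma mem_roots {p : ℕ × ℕ} : p ∈ roots n ↔ IsRoot n p := by
  simp only [roots, Finset.mem_filter, Finset.mem_product, Finset.mem_Icc, IsRoot]
  omega

lemma IsFock.vec_X (h : IsFock n kappa lam S) (T : Gen →₀ MvPolynomial (ℕ × ℕ) ℂ) (q : ℕ × ℕ) :
    S.vec T (X q) = if IsRoot n q then T (.a q) else 0 := by
  induction T using Finsupp.induction_linear with
  | zero => simp
  | add T U hT hU =>
    rw [map_add, Derivation.add_apply, hT, hU, Finsupp.add_apply]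
    split_ifs <;> simp
  | single g f =>
    rw [FreeFields.vec, Finsupp.linearCombination_single, Derivation.smul_apply, FreeFields.der,
      MvPolynomial.mkDerivation_X, h.eps_eq]
    cases g with
    | a p =>
      by_cases hq : IsRoot n q <;> by_cases hp : p = q <;> simp [genEps, hp, hq]
    | b r => simp [genEps]
    | d p => simp [genEps]

lemma IsFock.bil_apply (h : IsFock n kappa lam S) (T U : Gen →₀ MvPolynomial (ℕ × ℕ) ℂ) :
    S.bil T U = ∑ p ∈ roots n, (T (.a p) * U (.d p) + T (.d p) * U (.a p)) +
      ∑ r ∈ Finset.Icc 1 n, ∑ s ∈ Finset.Icc 1 n,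
        C (genForm n (.b r) (.b s)) * (T (.b r) * U (.b s)) := by
  induction T using Finsupp.induction_linear with
  | zero => simp
  | add T T' hT hT' =>
    simp only [map_add, LinearMap.add_apply, hT, hT', Finsupp.add_apply, add_mul, mul_add,
      Finset.sum_add_distrib]
    ring
  | single g f =>
  induction U using Finsupp.induction_linear with
  | zero => simp
  | add U U' hU hU' =>
    simp only [map_add, hU, hU', Finsupp.add_apply, mul_add, Finset.sum_add_distrib]
    ring
  | single k e =>
    have : S.bil (.single g f) (.single k e) = C (genForm n g k) * (f * e) := by
      simp [FreeFields.bil, h.form_eq]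
      ring
    rw [this]
    cases g <;> cases k <;> simp [Finsupp.single_apply, ← mem_roots, genForm]
    case a.d p q =>
      by_cases hpq : p = q <;> simp [hpq]
    case d.a p q => simp only [ite_and, eq_comm]
    case b.b r s => split_ifs <;> simp_all

/-- The quadratic form of the finite Cartan matrix in terms of consecutive differences. -/
lemma sum_cartan {R : Type*} [CommRing R] (f : ℕ → R) (h0 : f 0 = 0) (n : ℕ) :
    ∑ r ∈ Finset.Icc 1 n, ∑ s ∈ Finset.Icc 1 n,
      (if r = s then -2 else if r + 1 = s ∨ s + 1 = r then 1 else 0) * (f r * f s) =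
      -2 * ∑ r ∈ Finset.Icc 1 n, f r * (f r - f (r - 1)) := by
  induction n with
  | zero => simp
  | succ n ih =>
    have key (c : ℕ → R) (hc : ∀ r ∈ Finset.Icc 1 n, c r = if r = n then f r * f (n + 1) else 0) :
        ∑ r ∈ Finset.Icc 1 n, c r = f n * f (n + 1) := by
      rw [Finset.sum_congr rfl hc, Finset.sum_ite_eq']
      split_ifs with hn
      · rfl
      · obtain rfl : n = 0 := by simpa [Nat.one_le_iff_ne_zero] using hn
        rw [h0, zero_mul]
    have e1 : ∑ r ∈ Finset.Icc 1 n,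
        (if r = n + 1 then -2 else if r + 1 = n + 1 ∨ n + 1 + 1 = r then 1 else 0) *
          (f r * f (n + 1)) = f n * f (n + 1) := key _ fun r hr => by
      have := (Finset.mem_Icc.1 hr).2
      rw [if_neg (by omega)]
      by_cases h : r = n
      · rw [if_pos (by omega), if_pos h, one_mul]
      · rw [if_neg (by omega), if_neg h, zero_mul]
    have e2 : ∑ s ∈ Finset.Icc 1 n,
        (if n + 1 = s then -2 else if n + 1 + 1 = s ∨ s + 1 = n + 1 then 1 else 0) *
          (f (n + 1) * f s) = f n * f (n + 1) := key _ fun r hr => by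
      have := (Finset.mem_Icc.1 hr).2
      rw [if_neg (by omega)]
      by_cases h : r = n
      · rw [if_pos (by omega), if_pos h, one_mul, mul_comm]
      · rw [if_neg (by omega), if_neg h, zero_mul]
    simp only [Finset.sum_Icc_succ_top (Nat.le_add_left 1 n), Finset.sum_add_distrib, ih, e1, e2,
      if_true, Nat.add_sub_cancel]
    ring

lemma C_two : (C 2 : MvPolynomial (ℕ × ℕ) ℂ) = 2 := map_ofNat C 2

lemma IsFock.bil_symF (h : IsFock n kappa lam S) (r : ℕ) : S.bil (symF r) (symF r) = 0 := by
  simp [h.bil_apply]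

lemma IsFock.bil_symE0 (h : IsFock n kappa lam S) : S.bil (symE0 n) (symE0 n) = 0 := by
  simp [h.bil_apply]

lemma IsFock.bil_symE (h : IsFock n kappa lam S) {r : ℕ} (h1 : 1 ≤ r) (h2 : r ≤ n) :
    S.bil (symE n r) (symE n r) = 0 := by
  have hr : (r, r + 1) ∈ roots n := mem_roots.2 ⟨h1, by simp, by simpa⟩
  simp [h.bil_apply, symE_b, symE_d, Finset.sum_add_distrib, hr, genForm, h1, h2, symE_a, C_two]
  ring

lemma IsFock.bil_symF0 (h : IsFock n kappa lam S) : S.bil (symF0 n) (symF0 n) = 0 := by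
  have hd : ∑ p ∈ roots n, symF0 n (.a p) * symF0 n (.d p) =
      ∑ r ∈ Finset.Icc 1 n, pathG n r * (pathG n r - pathG n (r - 1)) := by
    simp only [symF0_d, Finset.mul_sum, mul_ite, mul_zero]
    rw [Finset.sum_comm]
    refine Finset.sum_congr rfl fun r hr => ?_
    obtain ⟨h1, h2⟩ := Finset.mem_Icc.1 hr
    rw [Finset.sum_ite_eq, if_pos (mem_roots.2 ⟨h1, by simpa using Nat.lt_succ_of_le h2, le_rfl⟩),
      symF0_a, if_pos (by omega), pathV_eq h1 (by omega) le_rfl, ← pathG_eq]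
    obtain ⟨r, rfl⟩ := Nat.exists_eq_add_of_le' h1
    rw [Nat.add_sub_cancel, pathG_eq n (r + 1), Finset.sum_Icc_succ_top h1, ← pathG_eq]
    ring
  have hb : ∑ r ∈ Finset.Icc 1 n, ∑ s ∈ Finset.Icc 1 n,
        C (genForm n (.b r) (.b s)) * (symF0 n (.b r) * symF0 n (.b s)) =
      -2 * ∑ r ∈ Finset.Icc 1 n, pathG n r * (pathG n r - pathG n (r - 1)) := by
    rw [← sum_cartan _ (by simp [pathG_eq])]
    refine Finset.sum_congr rfl fun r hr => Finset.sum_congr rfl fun s hs => ?_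
    rw [Finset.mem_Icc] at hr hs
    simp only [symF0_b, genForm, hr, hs, and_self, if_true, neg_mul_neg]
    split_ifs <;> simp [C_two]
  rw [h.bil_apply, hb, Finset.sum_add_distrib, hd,
    Finset.sum_congr rfl fun p _ => mul_comm (symF0 n (.d p)) (symF0 n (.a p)), hd]
  ring

end Contractions

section VectorFields

open MvPolynomial (X C)

variable {n N : ℕ} {pos : MM N → Prop} {kappa : MM N → Fin (N + 1) → ℂ} {lam : ℕ → ℂ}
  {S : FreeFields (MM N) (Fock n N pos) (ℕ × ℕ) Gen} {r s i j : ℕ}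

lemma IsFock.vec_X_of_isRoot (h : IsFock n kappa lam S) (T : Gen →₀ MvPolynomial (ℕ × ℕ) ℂ)
    (h1 : 1 ≤ i) (h2 : i < j) (h3 : j ≤ n + 1) : S.vec T (X (i, j)) = T (.a (i, j)) := by
  rw [h.vec_X, if_pos ⟨h1, h2, h3⟩]

lemma symE_a_diag (hi : i = r) (hj : j = r + 1) :
    symE n r (.a (i, j)) = X (r, r + 1) * X (r, r + 1) := by
  simp (disch := omega) only [symE_a, if_pos, if_neg, sub_zero, add_zero]

lemma symE_a_row (hi : i = r) (hj : r + 2 ≤ j) (hn : j ≤ n + 1) :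
    symE n r (.a (i, j)) = X (r, j) * X (r, r + 1) := by
  simp (disch := omega) only [symE_a, if_pos, if_neg, sub_zero, add_zero, zero_add]

lemma symE_a_succ (hi : i = r + 1) (hj : r + 2 ≤ j) (hn : j ≤ n + 1) :
    symE n r (.a (i, j)) = -X (r, j) - X (r + 1, j) * X (r, r + 1) := by
  simp (disch := omega) only [symE_a, if_pos, if_neg, zero_sub, add_zero]
  ring

lemma symE_a_col (hj : j = r) (h1 : 1 ≤ i) (hi : i < r) :
    symE n r (.a (i, j)) = X (i, r + 1) := by
  simp (disch := omega) only [symE_a, if_pos, if_neg, sub_zero, add_zero, zero_add]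

lemma symE_a_zero (hr : r ≤ n) (h1 : ¬(i = r ∧ r + 1 ≤ j ∧ j ≤ n + 1))
    (h2 : ¬(i = r + 1 ∧ r + 2 ≤ j ∧ j ≤ n + 1)) (h3 : ¬(j = r ∧ 1 ≤ i ∧ i < r)) :
    symE n r (.a (i, j)) = 0 := by
  simp (disch := omega) only [symE_a, if_neg, sub_zero, add_zero]

lemma IsFock.vec_symE_comm (h : IsFock n kappa lam S) (hr : 1 ≤ r) (hrs : r + 2 ≤ s)
    (hs : s ≤ n) (g : Gen) : S.vec (symE n s) (symE n r g) = S.vec (symE n r) (symE n s g) := by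
  rcases g with ⟨i, j⟩ | k | p
  · by_cases h1 : i = r ∧ r + 1 ≤ j ∧ j ≤ n + 1
    · obtain ⟨rfl, hj, hn⟩ := h1
      obtain rfl | hj := hj.eq_or_lt
      · simp (disch := omega) only [symE_a_diag, symE_a_zero, h.vec_X_of_isRoot,
          Derivation.leibniz, map_zero, smul_zero, add_zero]
      · obtain rfl | hj' := eq_or_ne j s
        · simp (disch := omega) only [symE_a_row, symE_a_col, symE_a_zero, h.vec_X_of_isRoot,
            Derivation.leibniz, smul_eq_mul]
          ring
        · simp (disch := omega) only [symE_a_row, symE_a_zero, h.vec_X_of_isRoot,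
            Derivation.leibniz, map_zero, smul_zero, add_zero]
    by_cases h2 : i = r + 1 ∧ r + 2 ≤ j ∧ j ≤ n + 1
    · obtain ⟨rfl, hj, hn⟩ := h2
      obtain rfl | hj' := eq_or_ne j s
      · simp (disch := omega) only [symE_a_succ, symE_a_col, symE_a_zero, h.vec_X_of_isRoot,
            Derivation.leibniz, smul_eq_mul, map_sub, map_neg]
        ring
      · simp (disch := omega) only [symE_a_succ, symE_a_zero, h.vec_X_of_isRoot,
            Derivation.leibniz, map_zero, smul_zero, add_zero, map_sub, map_neg, neg_zero, sub_zero]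
    by_cases h3 : j = r ∧ 1 ≤ i ∧ i < r
    · obtain ⟨rfl, hi, hir⟩ := h3
      simp (disch := omega) only [symE_a_col, symE_a_zero, h.vec_X_of_isRoot, map_zero]
    rw [symE_a_zero (by omega) h1 h2 h3, map_zero]
    by_cases h4 : i = s ∧ s + 1 ≤ j ∧ j ≤ n + 1
    · obtain ⟨rfl, hj, hn⟩ := h4
      obtain rfl | hj := hj.eq_or_lt
      · simp (disch := omega) only [symE_a_diag, symE_a_zero, h.vec_X_of_isRoot,
          Derivation.leibniz, smul_zero, add_zero]
      · simp (disch := omega) only [symE_a_row, symE_a_zero, h.vec_X_of_isRoot,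
          Derivation.leibniz, smul_zero, add_zero]
    by_cases h5 : i = s + 1 ∧ s + 2 ≤ j ∧ j ≤ n + 1
    · obtain ⟨rfl, hj, hn⟩ := h5
      simp (disch := omega) only [symE_a_succ, symE_a_zero, h.vec_X_of_isRoot,
        Derivation.leibniz, smul_zero, add_zero, map_sub, map_neg, neg_zero, sub_zero]
    by_cases h6 : j = s ∧ 1 ≤ i ∧ i < s
    · obtain ⟨rfl, hi, his⟩ := h6
      simp (disch := omega) only [symE_a_col, symE_a_zero, h.vec_X_of_isRoot]
    rw [symE_a_zero hs h4 h5 h6, map_zero]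
  · simp only [symE_b, apply_ite, map_zero]
    simp (disch := omega) only [symE_a_zero, h.vec_X_of_isRoot, ite_self]
  · simp only [symE_d, apply_ite, map_zero, Derivation.map_one_eq_zero, ite_self]

lemma IsFock.form_symE (h : IsFock n kappa lam S) (hrs : r + 2 ≤ s) (hs : s ≤ n) (g k : Gen)
    (hg : symE n r g ≠ 0) (hk : symE n s k ≠ 0) : S.form g k = 0 := by
  rw [h.form_eq]
  rcases g with p | t | p <;> rcases k with q | u | q <;> try rfl
  · refine if_neg fun hpq => ?_
    obtain ⟨-, rfl⟩ := hpq
    obtain rfl : p = (s, s + 1) := by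
      by_contra hp
      exact hk (by rw [symE_d, if_neg hp])
    exact hg (symE_a_zero (by omega) (by omega) (by omega) (by omega))
  · have ht : t = r := by
      by_contra ht
      exact hg (by rw [symE_b, if_neg ht])
    have hu : u = s := by
      by_contra hu
      exact hk (by rw [symE_b, if_neg hu])
    simp (disch := omega) [genForm, if_neg]
  · refine if_neg fun hpq => ?_
    obtain ⟨-, rfl⟩ := hpq
    obtain rfl : q = (r, r + 1) := by
      by_contra hq
      exact hg (by rw [symE_d, if_neg hq])
    exact hk (symE_a_zero (by omega) (by omega) (by omega) (by omega))

end VectorFields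

section VectorFields

open MvPolynomial (X C)

variable {n N : ℕ} {pos : MM N → Prop} {kappa : MM N → Fin (N + 1) → ℂ} {lam : ℕ → ℂ}
  {S : FreeFields (MM N) (Fock n N pos) (ℕ × ℕ) Gen} {r s i j k : ℕ}

lemma symF_a_diag (hi : i = s) (hj : j = s + 1) : symF s (.a (i, j)) = 1 := by
  simp (disch := omega) only [symF_a, if_pos, if_neg, sub_zero]

lemma symF_a_col (hj : j = s + 1) (h1 : 1 ≤ i) (hi : i < s) :
    symF s (.a (i, j)) = -X (i, s) := by
  simp (disch := omega) only [symF_a, if_pos, if_neg, zero_sub]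

lemma symF_a_zero (h : ¬(j = s + 1 ∧ 1 ≤ i ∧ i ≤ s)) (hs : 1 ≤ s) : symF s (.a (i, j)) = 0 := by
  simp (disch := omega) only [symF_a, if_neg, sub_zero]

lemma IsFock.vec_symF_symF (h : IsFock n kappa lam S) (hr : 1 ≤ r) (hrn : r ≤ n) (hs : 1 ≤ s)
    (hrs : r ≠ s + 1) (g : Gen) : S.vec (symF s) (symF r g) = 0 := by
  rcases g with ⟨i, j⟩ | k | p
  · by_cases h1 : j = r + 1 ∧ 1 ≤ i ∧ i ≤ r
    · obtain ⟨rfl, h1, h2⟩ := h1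
      obtain rfl | h2 := h2.eq_or_lt
      · rw [symF_a_diag rfl rfl, Derivation.map_one_eq_zero]
      · simp (disch := omega) only [symF_a_col, symF_a_zero, h.vec_X_of_isRoot, map_neg, neg_zero]
    · rw [symF_a_zero h1 hr, map_zero]
  · rw [symF_b, map_zero]
  · rw [symF_d, map_zero]

lemma IsFock.form_symF (h : IsFock n kappa lam S) (g k : Gen)
    (hg : symF r g ≠ 0) (hk : symF s k ≠ 0) : S.form g k = 0 := by
  rw [h.form_eq]
  rcases g with p | t | p
  · rcases k with q | u | q
    · rfl
    · rfl
    · exact (hk (symF_d _ _)).elim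
  · exact (hg (symF_b _ _)).elim
  · exact (hg (symF_d _ _)).elim

lemma vec_symE_symE0 (g : Gen) :
    S.vec (symE n s) (symE0 n g) = 0 := by
  rcases g with p | k | p
  · rw [symE0_a]
    split_ifs <;> simp
  · rw [symE0_b, map_zero]
  · rw [symE0_d, map_zero]

lemma symE0_a_zero (hij : i ≠ 1 ∨ j ≠ n + 1) : symE0 n (.a (i, j)) = 0 := by
  rw [symE0_a, if_neg]
  rw [Prod.mk.injEq]
  omega

lemma IsFock.vec_symE0_symE (h : IsFock n kappa lam S) (hs : 2 ≤ s) (hsn : s < n) (g : Gen) :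
    S.vec (symE0 n) (symE n s g) = 0 := by
  rcases g with ⟨i, j⟩ | k | p
  · by_cases h4 : i = s ∧ s + 1 ≤ j ∧ j ≤ n + 1
    · obtain ⟨rfl, hj, hn⟩ := h4
      obtain rfl | hj := hj.eq_or_lt
      · simp (disch := omega) only [symE_a_diag, symE0_a_zero, h.vec_X_of_isRoot,
          Derivation.leibniz, smul_zero, add_zero]
      · simp (disch := omega) only [symE_a_row, symE0_a_zero, h.vec_X_of_isRoot,
          Derivation.leibniz, smul_zero, add_zero]
    by_cases h5 : i = s + 1 ∧ s + 2 ≤ j ∧ j ≤ n + 1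
    · obtain ⟨rfl, hj, hn⟩ := h5
      simp (disch := omega) only [symE_a_succ, symE0_a_zero, h.vec_X_of_isRoot,
        Derivation.leibniz, smul_zero, add_zero, map_sub, map_neg, neg_zero, sub_zero]
    by_cases h6 : j = s ∧ 1 ≤ i ∧ i < s
    · obtain ⟨rfl, hi, his⟩ := h6
      simp (disch := omega) only [symE_a_col, symE0_a_zero, h.vec_X_of_isRoot]
    rw [symE_a_zero hsn.le h4 h5 h6, map_zero]
  · simp (disch := omega) only [symE_b, apply_ite, map_zero, symE0_a_zero, h.vec_X_of_isRoot,
      ite_self]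
  · simp only [symE_d, apply_ite, map_zero, Derivation.map_one_eq_zero, ite_self]

lemma IsFock.form_symE0 (h : IsFock n kappa lam S) (hs : 2 ≤ s) (g k : Gen)
    (hg : symE0 n g ≠ 0) (hk : symE n s k ≠ 0) : S.form g k = 0 := by
  rw [h.form_eq]
  rcases g with ⟨i, j⟩ | t | p
  · rcases k with q | u | q
    · rfl
    · rfl
    · refine if_neg fun hpq => ?_
      obtain ⟨-, rfl⟩ := hpq
      have : (i, j) = (s, s + 1) := by
        by_contra hq
        exact hk (by rw [symE_d, if_neg hq])
      rw [Prod.mk.injEq] at this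
      exact hg (symE0_a_zero (by omega))
  · exact (hg (symE0_b _ _)).elim
  · exact (hg (symE0_d _ _)).elim

lemma IsFock.vec_symF_sum (h : IsFock n kappa lam S)
    (hP : ∀ k, 1 ≤ k → k ≤ i → S.vec (symF s) (pathP n k) = 0)
    (hij : i < j) (hj : j ≤ n + 1) :
    S.vec (symF s) (∑ k ∈ Finset.Icc 1 i, pathP n k * X (k, j)) =
      ∑ k ∈ Finset.Icc 1 i, pathP n k * symF s (.a (k, j)) := by
  rw [map_sum]
  refine Finset.sum_congr rfl fun k hk => ?_
  rw [Finset.mem_Icc] at hk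
  rw [Derivation.leibniz, hP k hk.1 hk.2, smul_zero, add_zero, smul_eq_mul,
    h.vec_X_of_isRoot _ hk.1 (by omega) hj]

lemma sum_pathP_mul_symF_zero (hs : 2 ≤ s) (hsn : s < n) (hij : i < j) (hj : j ≠ s + 1 ∨ i = s) :
    ∑ k ∈ Finset.Icc 1 i, pathP n k * symF s (.a (k, j)) = 0 := by
  by_cases hj' : j = s + 1
  · obtain rfl : i = s := by omega
    obtain ⟨t, rfl⟩ := Nat.exists_eq_add_of_le' (by omega : 1 ≤ i)
    rw [Finset.sum_Icc_succ_top (by omega), symF_a_diag rfl hj', mul_one,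
      pathP_eq (by omega) (by omega), Nat.add_sub_cancel,
      pathV_eq (by omega) (by omega) (by omega), ← Finset.sum_add_distrib]
    refine Finset.sum_eq_zero fun k hk => ?_
    rw [Finset.mem_Icc] at hk
    rw [symF_a_col hj' hk.1 (by omega)]
    ring
  · refine Finset.sum_eq_zero fun k hk => ?_
    rw [symF_a_zero (by omega) (by omega), mul_zero]

lemma IsFock.vec_symF_pathP (h : IsFock n kappa lam S) (hs : 2 ≤ s) (hsn : s < n)
    (k : ℕ) (hk : 1 ≤ k) (hkn : k ≤ n + 1) :
    S.vec (symF s) (pathP n k) = 0 := by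
  induction k using Nat.strong_induction_on with
  | _ k ih =>
    obtain rfl | hk' := hk.eq_or_lt
    · rw [pathP_one, Derivation.map_one_eq_zero]
    · rw [pathP_eq hk' hkn, pathV_eq (by omega) (by omega) hkn,
        h.vec_symF_sum (fun l h1 h2 => ih l (by omega) h1 (by omega)) (by omega) hkn]
      exact sum_pathP_mul_symF_zero hs hsn (by omega) (by omega)

lemma IsFock.vec_symF_pathV (h : IsFock n kappa lam S) (hs : 2 ≤ s) (hsn : s < n)
    (hi : 1 ≤ i) (hij : i < j) (hj : j ≤ n + 1) :
    S.vec (symF s) (pathV n i j) = if j = s + 1 ∧ i < s then -pathV n i s else 0 := by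
  rw [pathV_eq hi hij hj,
    h.vec_symF_sum (fun k h1 h2 => h.vec_symF_pathP hs hsn k h1 (by omega)) hij hj]
  split_ifs with hc
  · rw [pathV_eq hi hc.2 (by omega), ← Finset.sum_neg_distrib]
    refine Finset.sum_congr rfl fun k hk => ?_
    rw [Finset.mem_Icc] at hk
    rw [symF_a_col hc.1 hk.1 (by omega), mul_neg]
  · exact sum_pathP_mul_symF_zero hs hsn hij (by omega)

lemma IsFock.vec_symF_pathG (h : IsFock n kappa lam S) (hs : 2 ≤ s) (hsn : s < n)
    (hi : i ≤ n) : S.vec (symF s) (pathG n i) = 0 := by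
  rw [pathG_eq, h.vec_symF_sum
    (fun k h1 h2 => h.vec_symF_pathP hs hsn k h1 (by omega)) (by omega) le_rfl]
  exact sum_pathP_mul_symF_zero hs hsn (by omega) (by omega)

lemma pathV_of_le (hij : j ≤ i) : pathV n i j = 0 :=
  Finset.sum_eq_zero fun _ _ => if_neg fun h => absurd h.1 hij.not_gt

lemma IsFock.vec_symF_symF0 (h : IsFock n kappa lam S) (hs : 2 ≤ s) (hsn : s < n) (g : Gen) :
    S.vec (symF s) (symF0 n g) = S.vec (symF0 n) (symF s g) := by
  rcases g with ⟨i, j⟩ | k | p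
  · by_cases hb : 1 ≤ i ∧ i < j ∧ j ≤ n + 1
    · obtain ⟨hi, hij, hj⟩ := hb
      rw [symF0_a, if_pos (by omega), map_neg, Derivation.leibniz,
        h.vec_symF_pathV hs hsn hi hij hj, h.vec_X_of_isRoot _ hi (by omega) le_rfl, symF_a_zero (by omega) (by omega), smul_zero,
        zero_add, smul_eq_mul]
      by_cases hc : j = s + 1 ∧ i < s
      · rw [if_pos hc, symF_a_col hc.1 hi hc.2, map_neg,
          h.vec_X_of_isRoot _ hi hc.2 (by omega), symF0_a, if_pos (by omega)]
        ring
      · rw [if_neg hc, mul_zero, neg_zero]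
        by_cases hd : i = s ∧ j = s + 1
        · rw [symF_a_diag hd.1 hd.2, Derivation.map_one_eq_zero]
        · rw [symF_a_zero (by omega) (by omega), map_zero]
    · rw [symF_a_zero (by omega) (by omega), map_zero, symF0_a]
      split_ifs
      · rw [pathV_of_le (by omega), zero_mul, neg_zero, map_zero]
      · rw [map_zero]
  · rw [symF_b, map_zero, symF0_b]
    split_ifs with hk
    · rw [map_neg, h.vec_symF_pathG hs hsn hk.2, neg_zero]
    · rw [map_zero]
  · rw [symF_d, map_zero, symF0_d, map_sum]
    refine Finset.sum_eq_zero fun k hk => ?_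
    rw [Finset.mem_Icc] at hk
    split_ifs
    · rw [map_neg, h.vec_symF_pathP hs hsn k hk.1 (by omega), neg_zero]
    · rw [map_zero]

lemma IsFock.form_symF0 (h : IsFock n kappa lam S) (hs : 1 ≤ s) (hsn : s < n) (g k : Gen)
    (hg : symF0 n g ≠ 0) (hk : symF s k ≠ 0) : S.form g k = 0 := by
  rw [h.form_eq]
  rcases k with ⟨i, j⟩ | t | p
  · rcases g with q | u | q
    · rfl
    · rfl
    · refine if_neg fun hpq => ?_
      obtain ⟨-, rfl⟩ := hpq
      refine hg ?_
      rw [symF0_d]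
      refine Finset.sum_eq_zero fun r hr => if_neg fun he => hk ?_
      rw [Prod.mk.injEq] at he
      exact symF_a_zero (by omega) hs
  · exact (hk (symF_b _ _)).elim
  · exact (hk (symF_d _ _)).elim

end VectorFields

section Commutators

variable {n N : ℕ} {pos : MM N → Prop} {kappa : MM N → Fin (N + 1) → ℂ} {lam : ℕ → ℂ}
  {S : FreeFields (MM N) (Fock n N pos) (ℕ × ℕ) Gen} {r s : ℕ}
  {Y Z : MM N → Fock n N pos → Fock n N pos} {T U : Gen →₀ MvPolynomial (ℕ × ℕ) ℂ}

lemma IsOp.comm_self (hY : IsOp S Y T) (h : S.bil T T = 0) (m k : MM N) :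
    comm (Y m) (Y k) = 0 := funext fun w => by
  simpa only [comm, hY _ _, Pi.zero_apply] using S.op_comm_self m k T h w

lemma IsOp.comm_eq_zero (hY : IsOp S Y T) (hZ : IsOp S Z U)
    (h : ∀ g, S.vec U (T g) = S.vec T (U g))
    (h0 : ∀ g g', T g ≠ 0 → U g' ≠ 0 → S.form g g' = 0) (m k : MM N) :
    comm (Y m) (Z k) = 0 := funext fun w => by
  simpa only [comm, hY _ _, hZ _ _, Pi.zero_apply] using S.op_comm_of_form_eq_zero m k T U h h0 w

lemma comm_swap_eq_zero {V : Type*} [AddCommGroup V] {f g : V → V} (h : comm f g = 0) :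
    comm g f = 0 := funext fun w => by
  simpa only [comm, Pi.zero_apply, sub_eq_zero, eq_comm] using congrFun h w

lemma Acar_symm (n r s : ℕ) : Acar n r s = Acar n s r := by
  simp only [Acar, AcarZ, eq_comm, or_comm]

/-- Distinct nodes `r < s` which are not adjacent in the affine Dynkin diagram. -/
lemma add_two_le_of_Acar_ne (hrs : r < s) (h : Acar n r s ≠ -1) :
    r + 2 ≤ s ∧ (r = 0 → s ≠ n) := by
  have h' : ¬((r + 1) % (n + 1) = s % (n + 1) ∨ (s + 1) % (n + 1) = r % (n + 1)) := fun h' =>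
    h (by simp [Acar, AcarZ, hrs.ne, h'])
  refine ⟨?_, ?_⟩
  · by_contra hs
    exact h' (.inl (by rw [show s = r + 1 by omega]))
  · rintro rfl rfl
    exact h' (.inr (by simp))

namespace IsFock

variable (h : IsFock n kappa lam S)
include h

lemma rhoE_zero : IsOp S (Stmt15.rhoE n N pos kappa lam 0) (symE0 n) := (h.aop 1 (n + 1)).neg

lemma rhoE_pos (h1 : 1 ≤ r) (h2 : r ≤ n) :
    IsOp S (Stmt15.rhoE n N pos kappa lam r) (symE n r) := fun m w => by
  rw [Stmt15.rhoE, if_neg (by omega), h.rhoEn h1 h2]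

lemma rhoFa_zero : IsOp S (Stmt15.rhoFa n N pos kappa lam 0) (symF0 n) := h.rhoF0

lemma rhoFa_pos (h1 : 1 ≤ r) : IsOp S (Stmt15.rhoFa n N pos kappa lam r) (symF r) := fun m w => by
  rw [Stmt15.rhoFa, if_neg (by omega), h.rhoF]

lemma comm_rhoE_self (hr : r ≤ n) (m k : MM N) :
    comm (Stmt15.rhoE n N pos kappa lam r m) (Stmt15.rhoE n N pos kappa lam r k) = 0 := by
  obtain rfl | h1 := r.eq_zero_or_pos
  · exact h.rhoE_zero.comm_self h.bil_symE0 m k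
  · exact (h.rhoE_pos h1 hr).comm_self (h.bil_symE h1 hr) m k

lemma comm_rhoFa_self (m k : MM N) :
    comm (Stmt15.rhoFa n N pos kappa lam r m) (Stmt15.rhoFa n N pos kappa lam r k) = 0 := by
  obtain rfl | h1 := r.eq_zero_or_pos
  · exact h.rhoFa_zero.comm_self h.bil_symF0 m k
  · exact (h.rhoFa_pos h1).comm_self (h.bil_symF r) m k

lemma comm_rhoE_of_lt (hrs : r < s) (hs : s ≤ n) (hA : Acar n r s ≠ -1) (m k : MM N) :
    comm (Stmt15.rhoE n N pos kappa lam r m) (Stmt15.rhoE n N pos kappa lam s k) = 0 := by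
  obtain ⟨h2, h3⟩ := add_two_le_of_Acar_ne hrs hA
  obtain rfl | h1 := r.eq_zero_or_pos
  · exact h.rhoE_zero.comm_eq_zero (h.rhoE_pos (by omega) hs)
      (fun g => by rw [vec_symE_symE0, h.vec_symE0_symE h2 (hs.lt_of_ne (h3 rfl))])
      (h.form_symE0 h2) m k
  · exact (h.rhoE_pos h1 (by omega)).comm_eq_zero (h.rhoE_pos (by omega) hs)
      (h.vec_symE_comm h1 h2 hs) (h.form_symE h2 hs) m k

lemma comm_rhoFa_of_lt (hrs : r < s) (hs : s ≤ n) (hA : Acar n r s ≠ -1) (m k : MM N) :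
    comm (Stmt15.rhoFa n N pos kappa lam r m) (Stmt15.rhoFa n N pos kappa lam s k) = 0 := by
  obtain ⟨h2, h3⟩ := add_two_le_of_Acar_ne hrs hA
  obtain rfl | h1 := r.eq_zero_or_pos
  · have hsn := hs.lt_of_ne (h3 rfl)
    exact h.rhoFa_zero.comm_eq_zero (h.rhoFa_pos (by omega)) (h.vec_symF_symF0 h2 hsn)
      (h.form_symF0 (by omega) hsn) m k
  · exact (h.rhoFa_pos h1).comm_eq_zero (h.rhoFa_pos (by omega))
      (fun g => by
        rw [h.vec_symF_symF h1 (by omega) (by omega) (by omega),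
          h.vec_symF_symF (by omega) hs h1 (by omega)])
      h.form_symF m k

end IsFock

end Commutators

/-- For all `0 ≤ r, s ≤ n` with `Â_{rs} ≠ -1` and all `m, n ∈ ℤ^{N+1}`,
`[ρ(E_r)_m, ρ(E_s)_n] = 0` and `[ρ(F_r)_m, ρ(F_s)_n] = 0` on `V`. -/
theorem stmt15 (n N : ℕ) (hn : 2 ≤ n) (hN : 1 ≤ N)
    (pos : MM N → Prop)
    (hadd : ∀ a b : MM N, pos a → pos b → pos (a + b))
    (htri : ∀ a : MM N, pos a ∨ a = 0 ∨ pos (-a))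
    (hzero : ¬ pos (0 : MM N))
    (hdisj : ∀ a : MM N, pos a → ¬ pos (-a))
    (kappa : MM N → Fin (N + 1) → ℂ) (lam : ℕ → ℂ)
    (hE1 : ∀ m : MM N, ∑ p : Fin (N + 1), (m p : ℂ) * kappa m p = 0)
    (hE2 : ∀ m k : MM N, pos m → pos k →
      ∑ p : Fin (N + 1), (m p : ℂ) * kappa (-m - k) p = 0) :
    ∀ r s : ℕ, r ≤ n → s ≤ n → Acar n r s ≠ -1 → ∀ m mm : MM N,
      comm (rhoE n N pos kappa lam r m) (rhoE n N pos kappa lam s mm) = 0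
      ∧ comm (rhoFa n N pos kappa lam r m) (rhoFa n N pos kappa lam s mm) = 0 := by
  intro r s hr hs hA m k
  have h := isFock_fockFields (n := n) htri hdisj kappa lam hE1 hE2
  obtain hrs | rfl | hrs := lt_trichotomy r s
  · exact ⟨h.comm_rhoE_of_lt hrs hs hA m k, h.comm_rhoFa_of_lt hrs hs hA m k⟩
  · exact ⟨h.comm_rhoE_self hr m k, h.comm_rhoFa_self m k⟩
  · rw [Acar_symm] at hA
    exact ⟨comm_swap_eq_zero (h.comm_rhoE_of_lt hrs hr hA k m),
      comm_swap_eq_zero (h.comm_rhoFa_of_lt hrs hr hA k m)⟩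

end Stmt15
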